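/- arXiv:math/0111087 — 3 statements merged into one kernel-verified Lean document; each statement's English description precedes it below -/
import Mathlib

section
/- Let a finitely generated group Γ act by isometries on a tree X with base point x₀. If asdim W_R(x₀) ≤ k for all R > 0, where W_R(x₀) = {g ∈ Γ : d_X(g·x₀, x₀) ≤ R} is the R-stabilizer, then asdim Γ ≤ k + 1. -/
open Set

/-- Asymptotic dimension `≤ n` of a set with a distance function `ρ`: for every `d > 0`
there are `n+1` uniformly bounded `d`-disjoint families of subsets covering the space. -/
def ASDimLEdist {Z : Type*} (ρ : Z → Z → ℝ) (n : ℕ) : Prop :=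
  ∀ d : ℝ, 0 < d → ∃ 𝔘 : Fin (n + 1) → Set (Set Z),
    (∀ i, (∃ R : ℝ, ∀ U ∈ 𝔘 i, ∀ x ∈ U, ∀ y ∈ U, ρ x y ≤ R) ∧
      (∀ U ∈ 𝔘 i, ∀ V ∈ 𝔘 i, U ≠ V → ∀ x ∈ U, ∀ y ∈ V, d ≤ ρ x y)) ∧
    ∀ z : Z, ∃ i, ∃ U ∈ 𝔘 i, z ∈ U

/-- The word distance on a group associated with a (symmetric) generating set `S`:
`wordDist S g h` is the least length of a word in the alphabet `S` representing
`g⁻¹ * h`. -/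
noncomputable def wordDist {Γ : Type*} [Group Γ] (S : Set Γ) (g h : Γ) : ℕ :=
  sInf {n : ℕ | ∃ l : List Γ, l.length = n ∧ (∀ s ∈ l, s ∈ S) ∧ l.prod = g⁻¹ * h}

namespace TreeAsdim

/-! ### Chains -/

/-- One step of a `d`-chain inside `A`. -/
def Step {Z : Type*} (ρ : Z → Z → ℕ) (A : Set Z) (d : ℕ) (a b : Z) : Prop :=
  a ∈ A ∧ b ∈ A ∧ ρ a b < d

/-- The `d`-components of `A` have diameter at most `R`. -/
def Ch {Z : Type*} (ρ : Z → Z → ℕ) (A : Set Z) (d R : ℕ) : Prop :=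
  ∀ x y, Relation.ReflTransGen (Step ρ A d) x y → ρ x y ≤ R

structure IsPM {Z : Type*} (ρ : Z → Z → ℕ) : Prop where
  self : ∀ x, ρ x x = 0
  symm : ∀ x y, ρ x y = ρ y x
  tri : ∀ x y z, ρ x z ≤ ρ x y + ρ y z

theorem Ch.merge {Z : Type*} {ρ : Z → Z → ℕ} (hρ : IsPM ρ) {A B : Set Z} {d R d' R' : ℕ}
    (hA : Ch ρ A d R) (hB : Ch ρ B d' R') (hd : R + 2 * d < d') :
    Ch ρ (A ∪ B) d (R' + 2 * (R + d)) := by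
  intro x y h
  have key : (Relation.ReflTransGen (Step ρ A d) x y) ∨
      (∃ b b', b ∈ B ∧ b' ∈ B ∧ ρ x b ≤ R + d ∧ Relation.ReflTransGen (Step ρ B d') b b' ∧
        (y = b' ∨ ∃ a, ρ b' a < d ∧ Relation.ReflTransGen (Step ρ A d) a y)) := by
    induction h with
    | refl => exact Or.inl .refl
    | @tail y z hxy hyz ih =>
      obtain ⟨hy, hz, hlt⟩ := hyz
      rcases ih with ih | ⟨b, b', hb, hb', hxb, hch, ih⟩
      · by_cases hzB : z ∈ B
        · right
          refine ⟨z, z, hzB, hzB, ?_, .refl, Or.inl rfl⟩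
          have := hA _ _ ih
          have := hρ.tri x y z
          omega
        · have hzA : z ∈ A := hz.resolve_right hzB
          by_cases hyA : y ∈ A
          · exact Or.inl (ih.tail ⟨hyA, hzA, hlt⟩)
          · have hyB : y ∈ B := hy.resolve_left hyA
            right
            refine ⟨y, y, hyB, hyB, ?_, .refl, Or.inr ⟨z, hlt, .refl⟩⟩
            have := hA _ _ ih
            omega
      · right
        by_cases hzB : z ∈ B
        · refine ⟨b, z, hb, hzB, hxb, hch.tail ⟨hb', hzB, ?_⟩, Or.inl rfl⟩
          rcases ih with rfl | ⟨a, ha, hay⟩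
          · omega
          · have := hA _ _ hay
            have := hρ.tri b' a y
            have := hρ.tri b' y z
            omega
        · have hzA : z ∈ A := hz.resolve_right hzB
          rcases ih with rfl | ⟨a, ha, hay⟩
          · exact ⟨b, y, hb, hb', hxb, hch, Or.inr ⟨z, hlt, .refl⟩⟩
          · by_cases hyA : y ∈ A
            · exact ⟨b, b', hb, hb', hxb, hch, Or.inr ⟨a, ha, hay.tail ⟨hyA, hzA, hlt⟩⟩⟩
            · have hyB : y ∈ B := hy.resolve_left hyA
              refine ⟨b, y, hb, hyB, hxb, hch.tail ⟨hb', hyB, ?_⟩, Or.inr ⟨z, hlt, .refl⟩⟩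
              have := hA _ _ hay
              have := hρ.tri b' a y
              omega
  rcases key with h | ⟨b, b', hb, hb', hxb, hch, h⟩
  · have := hA _ _ h
    omega
  · have h1 := hB _ _ hch
    have h2 := hρ.tri x b y
    have h3 := hρ.tri b b' y
    rcases h with rfl | ⟨a, ha, hay⟩
    · have := hρ.self y
      omega
    · have := hA _ _ hay
      have := hρ.tri b' a y
      omega

theorem rtg_mono {Z : Type*} {r p : Z → Z → Prop} {x y : Z} (h : Relation.ReflTransGen r x y)
    (hrp : ∀ a b, r a b → p a b) : Relation.ReflTransGen p x y := by
  induction h with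
  | refl => exact .refl
  | tail _ h ih => exact ih.tail (hrp _ _ h)

theorem Ch.mono {Z : Type*} {ρ : Z → Z → ℕ} {A B : Set Z} {d R R' : ℕ}
    (hB : Ch ρ B d R) (h : A ⊆ B) (hR : R ≤ R') : Ch ρ A d R' := by
  intro x y hxy
  exact (hB x y (rtg_mono hxy fun a b ⟨h1, h2, h3⟩ => ⟨h h1, h h2, h3⟩)).trans hR

/-- From chain-bounded sets to `ASDimLEdist`. -/
theorem asdim_of_ch {Z : Type*} {ρ : Z → Z → ℕ} (hρ : IsPM ρ) (n : ℕ)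
    (H : ∀ d : ℕ, ∃ R, ∃ A : Fin (n + 1) → Set Z, (∀ i, Ch ρ (A i) d R) ∧ ∀ z, ∃ i, z ∈ A i) :
    ASDimLEdist (fun a b => (ρ a b : ℝ)) n := by
  intro d _
  obtain ⟨N, hN⟩ := exists_nat_ge d
  obtain ⟨R, A, hA, hcov⟩ := H N
  have hsymm : ∀ i, Std.Symm (Step ρ (A i) N) := by
    intro i
    exact ⟨fun a b ⟨h1, h2, h3⟩ => ⟨h2, h1, by rw [hρ.symm]; exact h3⟩⟩
  have hs : ∀ i x y, Relation.ReflTransGen (Step ρ (A i) N) x y →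
      Relation.ReflTransGen (Step ρ (A i) N) y x := by
    intro i x y h
    induction h with
    | refl => exact .refl
    | tail _ h ih => exact .head ((hsymm i).symm _ _ h) ih
  have hmem : ∀ i x y, x ∈ A i → Relation.ReflTransGen (Step ρ (A i) N) x y → y ∈ A i := by
    intro i x y hx h
    cases h with
    | refl => exact hx
    | tail _ h => exact h.2.1
  refine ⟨fun i => {U | ∃ x ∈ A i, U = {y | Relation.ReflTransGen (Step ρ (A i) N) x y}},
    fun i => ⟨⟨R, ?_⟩, ?_⟩, ?_⟩
  · rintro U ⟨u, hu, rfl⟩ x hx y hy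
    have := hA i x y ((hs _ _ _ hx).trans hy)
    show (ρ x y : ℝ) ≤ (R : ℝ)
    exact_mod_cast this
  · rintro U ⟨u, hu, rfl⟩ V ⟨v, hv, rfl⟩ hne x hx y hy
    by_contra hlt
    push Not at hlt
    apply hne
    have hlt' : ρ x y < N := by exact_mod_cast hlt.trans_le hN
    have hst : Step ρ (A i) N x y := ⟨hmem _ _ _ hu hx, hmem _ _ _ hv hy, hlt'⟩
    have huv : Relation.ReflTransGen (Step ρ (A i) N) u v :=
      (Relation.ReflTransGen.tail hx hst).trans (hs _ _ _ hy)
    ext z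
    exact ⟨fun h => (hs _ _ _ huv).trans h, fun h => huv.trans h⟩
  · intro z
    obtain ⟨i, hi⟩ := hcov z
    exact ⟨i, _, ⟨z, hi, rfl⟩, Relation.ReflTransGen.refl⟩

/-- The Kolmogorov trick: with one more colour, every point is covered twice. -/
theorem kolmogorov {Z : Type*} {ρ : Z → Z → ℕ} (hρ : IsPM ρ) (k : ℕ)
    (H : ASDimLEdist (fun a b => (ρ a b : ℝ)) k) (d : ℕ) (hd : 0 < d) :
    ∃ R, ∃ A : Fin (k + 2) → Set Z, (∀ i, Ch ρ (A i) d R) ∧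
      ∀ z, ∃ i j, i ≠ j ∧ z ∈ A i ∧ z ∈ A j := by
  obtain ⟨𝔘, h𝔘, hcov⟩ := H (3 * d : ℕ) (by positivity)
  choose hb hdis using h𝔘
  choose R hR using hb
  obtain ⟨M, hM⟩ : ∃ M : ℕ, ∀ i, R i ≤ M := by
    obtain ⟨M, hM⟩ := exists_nat_ge (∑ i, |R i|)
    refine ⟨M, fun i => le_trans ?_ hM⟩
    exact (le_abs_self _).trans
      (Finset.single_le_sum (f := fun i => |R i|) (fun _ _ => abs_nonneg _) (Finset.mem_univ i))
  have hbd : ∀ i, ∀ U ∈ 𝔘 i, ∀ x ∈ U, ∀ y ∈ U, ρ x y ≤ M := by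
    intro i U hU x hx y hy
    have : (ρ x y : ℝ) ≤ (M : ℝ) := (hR i U hU x hx y hy).trans (hM i)
    exact_mod_cast this
  have heq : ∀ i, ∀ U ∈ 𝔘 i, ∀ V ∈ 𝔘 i, ∀ x ∈ U, ∀ y ∈ V, ρ x y < 3 * d → U = V := by
    intro i U hU V hV x hx y hy hlt
    by_contra hne
    have h : ((3 * d : ℕ) : ℝ) ≤ (ρ x y : ℝ) := hdis i U hU V hV hne x hx y hy
    have : 3 * d ≤ ρ x y := by exact_mod_cast h
    omega
  let B : Fin (k + 1) → Set Z := fun i => {z | ∃ U ∈ 𝔘 i, ∃ u ∈ U, ρ z u < d}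
  let C : Set Z := {z | ∃ i, (∃ U ∈ 𝔘 i, z ∈ U) ∧ ∀ j, j ≠ i → z ∉ B j}
  have hB : ∀ i, Ch ρ (B i) d (M + 2 * d) := by
    intro i x y h
    by_cases hx : x ∈ B i
    · obtain ⟨U, hU, u, hu, hxu⟩ := hx
      have : ∃ v ∈ U, ρ y v < d := by
        induction h with
        | refl => exact ⟨u, hu, hxu⟩
        | @tail y z _ hyz ih =>
          obtain ⟨v, hv, hyv⟩ := ih
          obtain ⟨_, ⟨V, hV, w, hw, hzw⟩, hlt⟩ := hyz
          have h1 := hρ.tri v y w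
          have h2 := hρ.tri y z w
          have h3 := hρ.symm v y
          have := heq i U hU V hV v hv w hw (by omega)
          subst this
          exact ⟨w, hw, hzw⟩
      obtain ⟨v, hv, hyv⟩ := this
      have h1 := hρ.tri x u y
      have h2 := hρ.tri u v y
      have h3 := hρ.symm v y
      have h4 := hbd i U hU u hu v hv
      omega
    · rcases h.cases_head with rfl | ⟨c, hc, _⟩
      · rw [hρ.self]; omega
      · exact absurd hc.1 hx
  have hC : Ch ρ C d (M + 2 * d) := by
    intro x y h
    by_cases hx : x ∈ C
    · obtain ⟨i, ⟨U, hU, hxU⟩, hx2⟩ := hx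
      have : y ∈ U ∧ ∀ j, j ≠ i → y ∉ B j := by
        induction h with
        | refl => exact ⟨hxU, hx2⟩
        | @tail y z _ hyz ih =>
          obtain ⟨hyU, hy2⟩ := ih
          obtain ⟨_, ⟨j, ⟨V, hV, hzV⟩, hz2⟩, hlt⟩ := hyz
          have hj : j = i := by
            by_contra hne
            exact hy2 j hne ⟨V, hV, z, hzV, hlt⟩
          subst hj
          have := heq j U hU V hV y hyU z hzV (by omega)
          subst this
          exact ⟨hzV, hz2⟩
      have := hbd i U hU x hxU y this.1
      omega
    · rcases h.cases_head with rfl | ⟨c, hc, _⟩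
      · rw [hρ.self]; omega
      · exact absurd hc.1 hx
  refine ⟨M + 2 * d, Fin.snoc (α := fun _ => Set Z) B C, ?_, ?_⟩
  · intro i
    refine Fin.lastCases ?_ (fun i => ?_) i
    · simpa using hC
    · simpa using hB i
  · intro z
    obtain ⟨i, U, hU, hz⟩ := hcov z
    have hzB : z ∈ B i := ⟨U, hU, z, hz, by rw [hρ.self]; exact hd⟩
    by_cases hex : ∃ j, j ≠ i ∧ z ∈ B j
    · obtain ⟨j, hj, hzj⟩ := hex
      exact ⟨i.castSucc, j.castSucc, by simpa using hj.symm, by simpa using hzB, by simpa using hzj⟩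
    · push Not at hex
      have hzC : z ∈ C := ⟨i, ⟨U, hU, hz⟩, hex⟩
      exact ⟨i.castSucc, Fin.last _, (Fin.castSucc_lt_last i).ne, by simpa using hzB,
        by simpa using hzC⟩

/-! ### Trees -/

theorem exists_anc {X : Type*} (T : SimpleGraph X) (hT : T.IsTree) (x₀ : X) :
    ∃ anc : X → ℕ → X,
      (∀ v n, T.dist v (anc v n) ≤ T.dist x₀ v - n) ∧
      (∀ v m n, n ≤ m → anc (anc v m) n = anc v n) ∧
      (∀ u v n, n ≤ T.dist x₀ u - T.dist u v → anc u n = anc v n) := by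
  classical
  have hc := hT.connected
  have huniq : ∀ u v w, T.Adj v u → T.Adj w u → T.dist x₀ u = T.dist x₀ v + 1 →
      T.dist x₀ u = T.dist x₀ w + 1 → v = w := by
    intro u v w hv hw h1 h2
    obtain ⟨p, hp⟩ := hc.exists_walk_length_eq_dist x₀ v
    obtain ⟨q, hq⟩ := hc.exists_walk_length_eq_dist x₀ w
    have hp' : (p.concat hv).IsPath :=
      SimpleGraph.Walk.isPath_of_length_eq_dist _ (by simp [hp, h1])
    have hq' : (q.concat hw).IsPath :=
      SimpleGraph.Walk.isPath_of_length_eq_dist _ (by simp [hq, h2])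
    have := (hT.existsUnique_path x₀ u).unique hp' hq'
    simpa using congrArg SimpleGraph.Walk.penultimate this
  have hex : ∀ u, ∃ v, (u = x₀ → v = x₀) ∧
      (u ≠ x₀ → T.Adj v u ∧ T.dist x₀ u = T.dist x₀ v + 1) := by
    intro u
    by_cases hu : u = x₀
    · exact ⟨x₀, fun _ => rfl, fun h => absurd hu h⟩
    · obtain ⟨p, hp⟩ := hc.exists_walk_length_eq_dist u x₀
      cases p with
      | nil => exact absurd rfl hu
      | @cons _ v _ h p =>
        refine ⟨v, fun h' => absurd h' hu, fun _ => ⟨h.symm, ?_⟩⟩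
        have h1 := SimpleGraph.dist_le p
        rw [SimpleGraph.Walk.length_cons] at hp
        rw [SimpleGraph.dist_comm (u := x₀), SimpleGraph.dist_comm (u := x₀)]
        have h2 : T.dist u v = 1 := SimpleGraph.dist_eq_one_iff_adj.2 h
        have h3 := hc.dist_triangle (u := u) (v := v) (w := x₀)
        omega
  choose par hpar0 hpar using hex
  have hdistpar : ∀ u, T.dist x₀ (par u) = T.dist x₀ u - 1 := by
    intro u
    by_cases hu : u = x₀
    · rw [hpar0 u hu, hu]; simp
    · have := (hpar u hu).2
      omega
  have hstep : ∀ u, T.dist u (par u) ≤ 1 := by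
    intro u
    by_cases hu : u = x₀
    · rw [hpar0 u hu, hu]; simp
    · exact (SimpleGraph.dist_eq_one_iff_adj.2 (hpar u hu).1.symm).le
  have hlev : ∀ j u, T.dist x₀ (par^[j] u) = T.dist x₀ u - j := by
    intro j
    induction j with
    | zero => intro u; simp
    | succ j ih =>
      intro u
      rw [Function.iterate_succ_apply, ih, hdistpar]
      omega
  have hd : ∀ j u, T.dist u (par^[j] u) ≤ j := by
    intro j
    induction j with
    | zero => intro u; simp
    | succ j ih =>
      intro u
      rw [Function.iterate_succ_apply]
      have h1 := ih (par u)
      have h2 := hstep u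
      have h3 := hc.dist_triangle (u := u) (v := par u) (w := par^[j] (par u))
      omega
  have hadjpar : ∀ u v, T.Adj u v → T.dist x₀ u = T.dist x₀ v + 1 → par u = v := by
    intro u v h h1
    have hu : u ≠ x₀ := by
      rintro rfl
      simp at h1
    exact huniq u _ _ (hpar u hu).1 h.symm (hpar u hu).2 h1
  have hadj : ∀ u v n, T.Adj u v → T.dist x₀ u = T.dist x₀ v + 1 → n ≤ T.dist x₀ v →
      par^[T.dist x₀ u - n] u = par^[T.dist x₀ v - n] v := by
    intro u v n h h1 hn
    have : T.dist x₀ u - n = (T.dist x₀ v - n) + 1 := by omega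
    rw [this, Function.iterate_succ_apply, hadjpar u v h h1]
  refine ⟨fun v n => par^[T.dist x₀ v - n] v, fun v n => hd _ _, ?_, ?_⟩
  · intro v m n hnm
    show par^[T.dist x₀ (par^[T.dist x₀ v - m] v) - n] (par^[T.dist x₀ v - m] v) = _
    rw [hlev, ← Function.iterate_add_apply]
    congr 1
    omega
  · have hwalk : ∀ u v (p : T.Walk u v) n, n ≤ T.dist x₀ u - p.length →
        par^[T.dist x₀ u - n] u = par^[T.dist x₀ v - n] v := by
      intro u v p
      induction p with
      | nil => intro n _; rfl
      | @cons u v w h p ih =>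
        intro n hn
        rw [SimpleGraph.Walk.length_cons] at hn
        have hcase := hT.dist_eq_dist_add_one_of_adj x₀ h
        rw [← ih n (by omega)]
        rcases hcase with h1 | h1
        · by_cases hn' : n ≤ T.dist x₀ v
          · exact hadj u v n h h1 hn'
          · omega
        · by_cases hn' : n ≤ T.dist x₀ u
          · exact (hadj v u n h.symm h1 hn').symm
          · omega
    intro u v n hn
    obtain ⟨p, hp⟩ := hc.exists_walk_length_eq_dist u v
    exact hwalk u v p n (by omega)

/-! ### The word metric -/

theorem word_exists {Γ : Type*} [Group Γ] (S : Finset Γ)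
    (hgen : Subgroup.closure (S : Set Γ) = ⊤) (hsym : ∀ s ∈ S, s⁻¹ ∈ S) (g h : Γ) :
    ∃ l : List Γ, l.length = wordDist (S : Set Γ) g h ∧ (∀ s ∈ l, s ∈ (S : Set Γ)) ∧
      l.prod = g⁻¹ * h := by
  have hne : {n : ℕ | ∃ l : List Γ, l.length = n ∧ (∀ s ∈ l, s ∈ (S : Set Γ)) ∧
      l.prod = g⁻¹ * h}.Nonempty := by
    have hm : g⁻¹ * h ∈ (Subgroup.closure (S : Set Γ)).toSubmonoid := by
      rw [hgen]; trivial
    rw [Subgroup.closure_toSubmonoid] at hm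
    obtain ⟨l, hl, hp⟩ := Submonoid.exists_list_of_mem_closure hm
    refine ⟨l.length, l, rfl, fun s hs => ?_, hp⟩
    rcases hl s hs with h | h
    · exact h
    · have := hsym _ (by simpa using h)
      simpa using this
  exact Nat.sInf_mem hne

theorem word_le {Γ : Type*} [Group Γ] (S : Set Γ) (g h : Γ) (l : List Γ)
    (hl : ∀ s ∈ l, s ∈ S) (hp : l.prod = g⁻¹ * h) : wordDist S g h ≤ l.length :=
  Nat.sInf_le ⟨l, rfl, hl, hp⟩

theorem word_isPM {Γ : Type*} [Group Γ] (S : Finset Γ)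
    (hgen : Subgroup.closure (S : Set Γ) = ⊤) (hsym : ∀ s ∈ S, s⁻¹ ∈ S) :
    IsPM (wordDist (S : Set Γ)) := by
  have hle : ∀ x y, wordDist (S : Set Γ) x y ≤ wordDist (S : Set Γ) y x := by
    intro x y
    obtain ⟨l, h1, h2, h3⟩ := word_exists S hgen hsym y x
    rw [← h1]
    refine (word_le _ x y (l.map (·⁻¹)).reverse ?_ ?_).trans (by simp)
    · intro s hs
      simp only [List.mem_reverse, List.mem_map] at hs
      obtain ⟨a, ha, rfl⟩ := hs
      exact hsym a (h2 a ha)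
    · rw [← List.prod_inv_reverse, h3]
      group
  refine ⟨fun x => ?_, fun x y => le_antisymm (hle x y) (hle y x), fun x y z => ?_⟩
  · have := word_le (S : Set Γ) x x [] (by simp) (by simp)
    simpa using this
  · obtain ⟨l, h1, h2, h3⟩ := word_exists S hgen hsym x y
    obtain ⟨l', h1', h2', h3'⟩ := word_exists S hgen hsym y z
    rw [← h1, ← h1', ← List.length_append]
    refine word_le _ x z (l ++ l') ?_ ?_
    · intro s hs
      rcases List.mem_append.1 hs with h | h
      · exact h2 s h
      · exact h2' s h
    · rw [List.prod_append, h3, h3']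
      group

theorem word_left {Γ : Type*} [Group Γ] (S : Set Γ) (a g h : Γ) :
    wordDist S (a * g) (a * h) = wordDist S g h := by
  unfold wordDist
  have : (a * g)⁻¹ * (a * h) = g⁻¹ * h := by group
  rw [this]

theorem dist_smul {Γ X : Type*} [Group Γ] [MulAction Γ X] (T : SimpleGraph X)
    (hT : T.Connected) (hiso : ∀ (g : Γ) (u v : X), T.Adj u v ↔ T.Adj (g • u) (g • v))
    (g : Γ) (u v : X) : T.dist (g • u) (g • v) = T.dist u v := by
  have hle : ∀ (g : Γ) u v, T.dist (g • u) (g • v) ≤ T.dist u v := by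
    intro g u v
    obtain ⟨p, hp⟩ := hT.exists_walk_length_eq_dist u v
    let f : T →g T := ⟨fun x => g • x, fun {a b} h => (hiso g a b).1 h⟩
    have := SimpleGraph.dist_le (p.map f)
    rw [SimpleGraph.Walk.length_map, hp] at this
    exact this
  refine le_antisymm (hle g u v) ?_
  have := hle g⁻¹ (g • u) (g • v)
  simpa using this

theorem word_lip {Γ X : Type*} [Group Γ] [MulAction Γ X] (S : Finset Γ)
    (hgen : Subgroup.closure (S : Set Γ) = ⊤) (hsym : ∀ s ∈ S, s⁻¹ ∈ S) (T : SimpleGraph X)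
    (hT : T.Connected) (hiso : ∀ (g : Γ) (u v : X), T.Adj u v ↔ T.Adj (g • u) (g • v))
    (x₀ : X) : ∃ L : ℕ, ∀ g h : Γ,
      T.dist (g • x₀) (h • x₀) ≤ L * wordDist (S : Set Γ) g h := by
  refine ⟨∑ s ∈ S, T.dist x₀ (s • x₀), fun g h => ?_⟩
  set L := ∑ s ∈ S, T.dist x₀ (s • x₀) with hL
  have hs : ∀ s ∈ S, T.dist x₀ (s • x₀) ≤ L := fun s hs =>
    Finset.single_le_sum (f := fun s => T.dist x₀ (s • x₀)) (fun _ _ => Nat.zero_le _) hs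
  have hl : ∀ l : List Γ, (∀ s ∈ l, s ∈ (S : Set Γ)) → T.dist x₀ (l.prod • x₀) ≤ L * l.length := by
    intro l
    induction l with
    | nil => simp
    | cons a l ih =>
      intro hmem
      have h1 := ih fun s hs => hmem s (List.mem_cons_of_mem _ hs)
      have h2 := hs a (hmem a (by simp))
      have h3 := hT.dist_triangle (u := x₀) (v := a • x₀) (w := a • (l.prod • x₀))
      rw [dist_smul T hT hiso] at h3
      rw [List.prod_cons, mul_smul, List.length_cons, mul_add, mul_one]
      omega
  obtain ⟨l, h1, h2, h3⟩ := word_exists S hgen hsym g h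
  have := hl l h2
  rw [h1, h3, ← dist_smul T hT hiso g, ← mul_smul] at this
  simpa using this

/-- Uniform two-fold covers of preimages of balls of the tree. -/
theorem ball_cover {Γ : Type*} [Group Γ] (S : Finset Γ)
    (hgen : Subgroup.closure (S : Set Γ) = ⊤) (hsym : ∀ s ∈ S, s⁻¹ ∈ S)
    {X : Type*} (T : SimpleGraph X) (hT : T.Connected)
    [MulAction Γ X]
    (hiso : ∀ (g : Γ) (u v : X), T.Adj u v ↔ T.Adj (g • u) (g • v))
    (x₀ : X) (k : ℕ)
    (hW : ∀ R : ℕ, ASDimLEdist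
      (fun a b : {g : Γ // T.dist (g • x₀) x₀ ≤ R} =>
        (wordDist (S : Set Γ) a.1 b.1 : ℝ)) k) (D d : ℕ) (hd : 0 < d) :
    ∃ R, ∃ A : X → Fin (k + 2) → Set Γ, (∀ p i, Ch (wordDist (S : Set Γ)) (A p i) d R) ∧
      ∀ p (h : Γ), T.dist (h • x₀) p ≤ D → ∃ i j, i ≠ j ∧ h ∈ A p i ∧ h ∈ A p j := by
  classical
  have hpm := word_isPM S hgen hsym
  have hpm' : IsPM (fun a b : {g : Γ // T.dist (g • x₀) x₀ ≤ 2 * D} =>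
      wordDist (S : Set Γ) a.1 b.1) :=
    ⟨fun x => hpm.self _, fun x y => hpm.symm _ _, fun x y z => hpm.tri _ _ _⟩
  obtain ⟨R, A, hA, hcov⟩ := kolmogorov hpm' k (hW (2 * D)) d hd
  have hg : ∀ p : X, ∃ g : Γ, (∃ h : Γ, T.dist (h • x₀) p ≤ D) → T.dist (g • x₀) p ≤ D := by
    intro p
    by_cases h : ∃ h : Γ, T.dist (h • x₀) p ≤ D
    · obtain ⟨g, hg⟩ := h
      exact ⟨g, fun _ => hg⟩
    · exact ⟨1, fun h' => absurd h' h⟩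
  choose g hg using hg
  refine ⟨R, fun p i => Set.image (fun w => g p * w.1) (A i), fun p i x y h => ?_, fun p h hp => ?_⟩
  · rcases h.cases_head with rfl | ⟨c, hc, _⟩
    · rw [hpm.self]; omega
    · obtain ⟨w, hw, hxw⟩ := hc.1
      clear hc
      rename_i hcy
      clear hcy
      subst hxw
      have : ∃ w', y = g p * w'.1 ∧ Relation.ReflTransGen
          (Step (fun a b : {g : Γ // T.dist (g • x₀) x₀ ≤ 2 * D} =>
            wordDist (S : Set Γ) a.1 b.1) (A i) d) w w' := by
        induction h with
        | refl => exact ⟨w, rfl, .refl⟩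
        | @tail y z _ hyz ih =>
          obtain ⟨w', rfl, hch⟩ := ih
          obtain ⟨⟨a, ha, hae⟩, ⟨b, hb, rfl⟩, hlt⟩ := hyz
          have hae' : a = w' := Subtype.ext (mul_left_cancel hae)
          subst hae'
          refine ⟨b, rfl, hch.tail ⟨ha, hb, ?_⟩⟩
          simpa [word_left] using hlt
      obtain ⟨w', rfl, hch⟩ := this
      have := hA i w w' hch
      simpa [word_left] using this
  · have hgp := hg p ⟨h, hp⟩
    have hmem : T.dist (((g p)⁻¹ * h) • x₀) x₀ ≤ 2 * D := by
      rw [← dist_smul T hT hiso (g p), ← mul_smul, mul_inv_cancel_left]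
      have h1 := hT.dist_triangle (u := h • x₀) (v := p) (w := g p • x₀)
      rw [SimpleGraph.dist_comm (u := p)] at h1
      omega
    obtain ⟨i, j, hij, hi, hj⟩ := hcov ⟨(g p)⁻¹ * h, hmem⟩
    exact ⟨i, j, hij, ⟨_, hi, by simp⟩, ⟨_, hj, by simp⟩⟩

theorem period_le {M t i s ℓx ℓy qx qy : ℕ} (hst : s < t) (hxy : ℓy ≤ ℓx + s)
    (h1 : ℓx < M * qx + i * t) (h2 : M * qy + (i * t + t) ≤ ℓy + M) : qy ≤ qx := by
  by_contra hlt
  push Not at hlt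
  have : M * (qx + 1) ≤ M * qy := Nat.mul_le_mul_left _ hlt
  rw [mul_add, mul_one] at this
  omega

theorem main_cover {Γ : Type*} [Group Γ] (S : Finset Γ)
    (hgen : Subgroup.closure (S : Set Γ) = ⊤) (hsym : ∀ s ∈ S, s⁻¹ ∈ S)
    {X : Type*} (T : SimpleGraph X) (hT : T.IsTree)
    [MulAction Γ X]
    (hiso : ∀ (g : Γ) (u v : X), T.Adj u v ↔ T.Adj (g • u) (g • v))
    (x₀ : X) (k : ℕ)
    (hW : ∀ R : ℕ, ASDimLEdist
      (fun a b : {g : Γ // T.dist (g • x₀) x₀ ≤ R} =>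
        (wordDist (S : Set Γ) a.1 b.1 : ℝ)) k) (d : ℕ) (hd : 0 < d) :
    ∃ R, ∃ A : Fin (k + 2) → Set Γ, (∀ i, Ch (wordDist (S : Set Γ)) (A i) d R) ∧
      ∀ z, ∃ i, z ∈ A i := by
  have hpm := word_isPM S hgen hsym
  have hc := hT.connected
  obtain ⟨L, hL⟩ := word_lip S hgen hsym T hc hiso x₀
  obtain ⟨anc, hancd, hanca, hancs⟩ := exists_anc T hT x₀
  -- step length in the tree
  obtain ⟨s, hs⟩ : ∃ s, ∀ g h : Γ, wordDist (S : Set Γ) g h < d →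
      T.dist (g • x₀) (h • x₀) ≤ s :=
    ⟨L * d, fun g h hlt => (hL g h).trans (Nat.mul_le_mul_left _ hlt.le)⟩
  obtain ⟨t, ht⟩ : ∃ t, t = s + 1 := ⟨_, rfl⟩
  obtain ⟨H, hH⟩ : ∃ H, H = (k + 2) * t := ⟨_, rfl⟩
  obtain ⟨M, hM⟩ : ∃ M, M = 2 * H := ⟨_, rfl⟩
  have htH : t ≤ H := by rw [hH]; exact Nat.le_mul_of_pos_left _ (by omega)
  have hiH : ∀ i : Fin (k + 2), i.val * t + t ≤ H := by
    intro i
    have : (i.val + 1) * t ≤ (k + 2) * t := Nat.mul_le_mul_right _ i.isLt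
    rw [hH]; rw [add_mul, one_mul] at this; exact this
  obtain ⟨lev, hlev⟩ : ∃ lev : Γ → ℕ, ∀ g, lev g = T.dist x₀ (g • x₀) := ⟨_, fun _ => rfl⟩
  have hlevs : ∀ g h : Γ, wordDist (S : Set Γ) g h < d → lev h ≤ lev g + s := by
    intro g h hlt
    have h1 := hs g h hlt
    have h2 := hc.dist_triangle (u := x₀) (v := g • x₀) (w := h • x₀)
    rw [hlev, hlev]; omega
  have hlevs' : ∀ g h : Γ, wordDist (S : Set Γ) g h < d → lev g ≤ lev h + s := by
    intro g h hlt
    exact hlevs h g (by rw [hpm.symm]; exact hlt)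
  have hMpos : 0 < M := by omega
  have hdm : ∀ g, M * (lev g / M) + lev g % M = lev g := fun g => Nat.div_add_mod _ _
  have hml : ∀ g, lev g % M < M := fun g => Nat.mod_lt _ hMpos
  have hanc_step : ∀ (g h : Γ) n, wordDist (S : Set Γ) g h < d → n ≤ lev g - s →
      anc (g • x₀) n = anc (h • x₀) n := by
    intro g h n hlt hn
    apply hancs
    have := hs g h hlt
    rw [← hlev]; omega
  obtain ⟨key, hkey⟩ : ∃ key : Γ → X, ∀ g, key g = anc (g • x₀) (M * (lev g / M) - M) :=
    ⟨_, fun _ => rfl⟩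
  have hkeyd : ∀ g, T.dist (g • x₀) (key g) ≤ 2 * M := by
    intro g
    have h1 := hancd (g • x₀) (M * (lev g / M) - M)
    have h2 := hdm g
    have h3 := hml g
    rw [← hkey, ← hlev] at h1
    omega
  obtain ⟨R, A, hA, hAcov⟩ := ball_cover S hgen hsym T hc hiso x₀ k hW (2 * M) d hd
  obtain ⟨R', V, hV, hVcov⟩ := ball_cover S hgen hsym T hc hiso x₀ k hW (2 * M)
    (R + 2 * d + 1) (by omega)
  -- the even part
  let E : Fin (k + 2) → Set Γ := fun i => {g | lev g % M < H ∧ g ∈ A (key g) i}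
  have hE : ∀ i, Ch (wordDist (S : Set Γ)) (E i) d R := by
    intro i x y h
    apply hA (key x) i
    have : key y = key x ∧
        Relation.ReflTransGen (Step (wordDist (S : Set Γ)) (A (key x) i) d) x y := by
      induction h with
      | refl => exact ⟨rfl, .refl⟩
      | @tail y z _ hyz ih =>
        obtain ⟨ih1, ih2⟩ := ih
        obtain ⟨⟨hy1, hy2⟩, ⟨hz1, hz2⟩, hlt⟩ := hyz
        have l1 := hlevs y z hlt
        have l2 := hlevs' y z hlt
        have d1 := hdm y
        have d2 := hdm z
        have hq : lev y / M = lev z / M := by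
          rcases lt_trichotomy (lev y / M) (lev z / M) with h | h | h
          · have := Nat.mul_le_mul_left M (Nat.succ_le_of_lt h)
            rw [Nat.succ_eq_add_one, mul_add, mul_one] at this
            omega
          · exact h
          · have := Nat.mul_le_mul_left M (Nat.succ_le_of_lt h)
            rw [Nat.succ_eq_add_one, mul_add, mul_one] at this
            omega
        have hk : key y = key z := by
          rw [hkey, hkey, ← hq]
          exact hanc_step y z _ hlt (by omega)
        refine ⟨hk ▸ ih1, ih2.tail ⟨ih1 ▸ hy2, ?_, hlt⟩⟩
        rw [← ih1, hk]; exact hz2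
    exact this.2
  let B : Fin (k + 2) → Set Γ := fun i =>
    {g | (H ≤ lev g % M ∧ g ∈ V (key g) i) ∨
      (g ∈ E i ∧ ¬ (i.val * t ≤ lev g % M ∧ lev g % M < i.val * t + t))}
  refine ⟨R' + 2 * (R + d), B, ?_, ?_⟩
  · intro i x y h
    have hi := hiH i
    -- period index for colour `i`
    obtain ⟨q, hq⟩ : ∃ q : Γ → ℕ, ∀ g, q g = lev g / M +
      (if i.val * t + t ≤ lev g % M then 1 else 0) := ⟨_, fun _ => rfl⟩
    have hBlay : ∀ g ∈ B i, ¬ (i.val * t ≤ lev g % M ∧ lev g % M < i.val * t + t) := by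
      rintro g (⟨h1, _⟩ | ⟨_, h⟩)
      · omega
      · exact h
    have hlow : ∀ g, M * q g + (i.val * t + t) ≤ lev g + M := by
      intro g
      have d1 := hdm g
      rw [hq]
      split_ifs <;> rw [mul_add] <;> omega
    have hup : ∀ g ∈ B i, lev g < M * q g + i.val * t := by
      intro g hg
      have h1 := hBlay g hg
      have d1 := hdm g
      have d2 := hml g
      rw [hq]
      split_ifs <;> rw [mul_add] <;> omega
    obtain ⟨κ, hκ⟩ : ∃ κ : Γ → X, ∀ g, κ g = anc (g • x₀) (M * q g + i.val * t - M) :=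
      ⟨_, fun _ => rfl⟩
    obtain ⟨p, hp⟩ : ∃ p, p = anc (κ x) (M * (q x - 1) - M) := ⟨_, rfl⟩
    have hodd : ∀ g, q g = q x → κ g = κ x → g ∈ B i → g ∈ E i ∪ V p i := by
      rintro g hgq hgκ (⟨h1, h2⟩ | ⟨h1, _⟩)
      · right
        have hgq' : q x = lev g / M + 1 := by
          rw [← hgq, hq, if_pos (by omega)]
        have : key g = p := by
          rw [hp, ← hgκ, hκ, hkey, hanca]
          · rw [hgq']; rfl
          · rw [hgq, hgq', mul_add]; simp only [Nat.add_sub_cancel]; omega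
        rw [← this]; exact h2
      · exact Or.inl h1
    apply (Ch.merge hpm (hE i) (hV p i) (by omega)) x y
    have : (q y = q x ∧ κ y = κ x) ∧
        Relation.ReflTransGen (Step (wordDist (S : Set Γ)) (E i ∪ V p i) d) x y := by
      induction h with
      | refl => exact ⟨⟨rfl, rfl⟩, .refl⟩
      | @tail y z _ hyz ih =>
        obtain ⟨⟨ih1, ih2⟩, ih3⟩ := ih
        obtain ⟨hy, hz, hlt⟩ := hyz
        have hqq : q z = q y := le_antisymm
          (period_le (by omega) (hlevs y z hlt) (hup y hy) (hlow z))
          (period_le (by omega) (hlevs' y z hlt) (hup z hz) (hlow y))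
        have hκκ : κ z = κ y := by
          rw [hκ, hκ, hqq]
          refine (hanc_step y z _ hlt ?_).symm
          have := hlow y
          omega
        exact ⟨⟨hqq.trans ih1, hκκ.trans ih2⟩, ih3.tail ⟨hodd y ih1 ih2 hy,
          hodd z (hqq.trans ih1) (hκκ.trans ih2) hz, hlt⟩⟩
    exact this.2
  · intro z
    by_cases hz : H ≤ lev z % M
    · obtain ⟨i, _, _, hi, _⟩ := hVcov (key z) z (hkeyd z)
      exact ⟨i, Or.inl ⟨hz, hi⟩⟩
    · push Not at hz
      obtain ⟨i, j, hij, hi, hj⟩ := hAcov (key z) z (hkeyd z)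
      by_cases hl : i.val * t ≤ lev z % M ∧ lev z % M < i.val * t + t
      · refine ⟨j, Or.inr ⟨⟨hz, hj⟩, fun hl' => ?_⟩⟩
        have hne : i.val ≠ j.val := fun h => hij (Fin.ext h)
        rcases lt_or_gt_of_ne hne with h | h
        · have := Nat.mul_le_mul_right t (Nat.succ_le_of_lt h)
          rw [Nat.succ_eq_add_one, add_mul, one_mul] at this
          omega
        · have := Nat.mul_le_mul_right t (Nat.succ_le_of_lt h)
          rw [Nat.succ_eq_add_one, add_mul, one_mul] at this
          omega
      · exact ⟨i, Or.inr ⟨⟨hz, hi⟩, hl⟩⟩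

end TreeAsdim

/-- Let a finitely generated group `Γ` act by isometries (simplicial automorphisms) on a
tree `X` with base point `x₀`. If `asdim W_R(x₀) ≤ k` for all `R`, where
`W_R(x₀) = {g : d(g·x₀, x₀) ≤ R}` is the `R`-stabilizer with the restricted word metric,
then `asdim Γ ≤ k + 1`. -/
theorem asdim_le_of_action_on_tree {Γ : Type*} [Group Γ] (S : Finset Γ)
    (hgen : Subgroup.closure (S : Set Γ) = ⊤) (hsym : ∀ s ∈ S, s⁻¹ ∈ S)
    {X : Type*} (T : SimpleGraph X) (hT : T.IsTree)
    [MulAction Γ X]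
    (hiso : ∀ (g : Γ) (u v : X), T.Adj u v ↔ T.Adj (g • u) (g • v))
    (x₀ : X) (k : ℕ)
    (hW : ∀ R : ℕ, ASDimLEdist
      (fun a b : {g : Γ // T.dist (g • x₀) x₀ ≤ R} =>
        (wordDist (S : Set Γ) a.1 b.1 : ℝ)) k) :
    ASDimLEdist (fun g h : Γ => (wordDist (S : Set Γ) g h : ℝ)) (k + 1) := by
  refine TreeAsdim.asdim_of_ch (TreeAsdim.word_isPM S hgen hsym) (k + 1) fun d => ?_
  obtain ⟨R, A, hA, hcov⟩ := TreeAsdim.main_cover S hgen hsym T hT hiso x₀ k hW (d + 1) (by omega)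
  refine ⟨R, A, fun i x y h => hA i x y (TreeAsdim.rtg_mono h ?_), hcov⟩
  rintro a b ⟨h1, h2, h3⟩
  exact ⟨h1, h2, by omega⟩
end

section
/- Assume a finitely generated group Γ acts by isometries on a tree X with compact orbit space and all vertex stabilizers Γ_x satisfy asdim Γ_x ≤ n. Then asdim Γ ≤ n + 1. -/
open Set

namespace AsdTree

/-- Axioms of an integer valued pseudometric. -/
structure PM {Z : Type*} (ρ : Z → Z → ℕ) : Prop where
  rfl' : ∀ x, ρ x x = 0
  symm' : ∀ x y, ρ x y = ρ y x
  tri : ∀ x y z, ρ x z ≤ ρ x y + ρ y z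

def Stp {Z : Type*} (ρ : Z → Z → ℕ) (d : ℕ) (D : Set Z) (a b : Z) : Prop :=
  a ∈ D ∧ b ∈ D ∧ ρ a b ≤ d

def Bd {Z : Type*} (ρ : Z → Z → ℕ) (d R : ℕ) (D : Set Z) : Prop :=
  ∀ x ∈ D, ∀ y, Relation.ReflTransGen (Stp ρ d D) x y → ρ x y ≤ R

def Cov {Z : Type*} (ρ : Z → Z → ℕ) (n d R : ℕ) (A : Set Z) : Prop :=
  ∃ D : Fin (n + 1) → Set Z, (∀ x ∈ A, ∃ i, x ∈ D i) ∧ ∀ i, Bd ρ d R (D i)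

def AD {Z : Type*} (ρ : Z → Z → ℕ) (n : ℕ) (A : Set Z) : Prop :=
  ∀ d, ∃ R, Cov ρ n d R A

def nb {Z : Type*} (ρ : Z → Z → ℕ) (c : ℕ) (D : Set Z) : Set Z :=
  {x | ∃ y ∈ D, ρ x y ≤ c}

variable {Z : Type*} {ρ : Z → Z → ℕ}

theorem Cov.mono {n d R R' : ℕ} {A A' : Set Z} (h : Cov ρ n d R A) (hR : R ≤ R')
    (hA : A' ⊆ A) : Cov ρ n d R' A' := by
  obtain ⟨D, h1, h2⟩ := h
  exact ⟨D, fun x hx => h1 x (hA hx), fun i x hx y hy => (h2 i x hx y hy).trans hR⟩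

theorem AD.mono {n : ℕ} {A A' : Set Z} (h : AD ρ n A) (hA : A' ⊆ A) : AD ρ n A' := by
  intro d
  obtain ⟨R, hR⟩ := h d
  exact ⟨R, hR.mono le_rfl hA⟩

theorem Bd.nb (hρ : PM ρ) {d c R : ℕ} {D : Set Z} (h : Bd ρ (d + 2 * c) R D) :
    Bd ρ d (R + 2 * c) (nb ρ c D) := by
  rintro x ⟨x0, hx0, hxx⟩ y hy
  have key : ∃ y0 ∈ D, ρ y y0 ≤ c ∧
      Relation.ReflTransGen (Stp ρ (d + 2 * c) D) x0 y0 := by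
    induction hy with
    | refl => exact ⟨x0, hx0, hxx, .refl⟩
    | @tail b e _ hbe ih =>
      obtain ⟨b0, hb0, hbb, hch⟩ := ih
      obtain ⟨-, ⟨e0, he0, hee⟩, hd⟩ := hbe
      refine ⟨e0, he0, hee, hch.tail ⟨hb0, he0, ?_⟩⟩
      have h1 := hρ.tri b0 b e0
      have h2 := hρ.tri b e e0
      have h3 := hρ.symm' b0 b
      omega
  obtain ⟨y0, hy0, hyy, hch⟩ := key
  have h0 := h x0 hx0 y0 hch
  have h1 := hρ.tri x x0 y
  have h2 := hρ.tri x0 y0 y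
  have h3 := hρ.symm' y0 y
  omega

theorem AD.nb (hρ : PM ρ) {n c : ℕ} {A : Set Z} (h : AD ρ n A) : AD ρ n (nb ρ c A) := by
  intro d
  obtain ⟨R, D, h1, h2⟩ := h (d + 2 * c)
  refine ⟨R + 2 * c, fun i => AsdTree.nb ρ c (D i), ?_, fun i => (h2 i).nb hρ⟩
  rintro x ⟨y, hy, hxy⟩
  obtain ⟨i, hi⟩ := h1 y hy
  exact ⟨i, y, hi, hxy⟩

/-- Kolmogorov trick. -/
theorem AD.kolm (hρ : PM ρ) {n : ℕ} {A : Set Z} (h : AD ρ n A) (d : ℕ) :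
    ∃ R, ∃ D : Fin (n + 1 + 1) → Set Z,
      (∀ x ∈ A, ∃ i j, i ≠ j ∧ x ∈ D i ∧ x ∈ D j) ∧ ∀ i, Bd ρ d R (D i) := by
  obtain ⟨R, D, h1, h2⟩ := h (d + 2 * d)
  refine ⟨R + 2 * d, Fin.lastCases
    {x | ∃ i, x ∈ D i ∧ ∀ j, j ≠ i → x ∉ AsdTree.nb ρ d (D j)}
    (fun i => AsdTree.nb ρ d (D i)), ?_, ?_⟩
  · intro x hx
    obtain ⟨i, hi⟩ := h1 x hx
    have hi' : x ∈ AsdTree.nb ρ d (D i) := ⟨x, hi, by rw [hρ.rfl']; omega⟩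
    by_cases hj : ∃ j, j ≠ i ∧ x ∈ AsdTree.nb ρ d (D j)
    · obtain ⟨j, hji, hj⟩ := hj
      refine ⟨i.castSucc, j.castSucc, ?_, by simpa using hi', by simpa using hj⟩
      intro hh
      exact hji (Fin.castSucc_injective _ hh).symm
    · push Not at hj
      refine ⟨i.castSucc, Fin.last _, Fin.castSucc_ne_last i, by simpa using hi', ?_⟩
      simp only [Fin.lastCases_last]
      exact ⟨i, hi, hj⟩
  · intro i
    induction i using Fin.lastCases with
    | cast i => simpa using (h2 i).nb hρ
    | last =>
      simp only [Fin.lastCases_last]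
      rintro x ⟨i, hi, hix⟩ y hy
      have key : (y ∈ D i ∧ ∀ j, j ≠ i → y ∉ AsdTree.nb ρ d (D j)) ∧
          Relation.ReflTransGen (Stp ρ (d + 2 * d) (D i)) x y := by
        induction hy with
        | refl => exact ⟨⟨hi, hix⟩, .refl⟩
        | @tail b e _ hbe ih =>
          obtain ⟨⟨hb, hb'⟩, hch⟩ := ih
          obtain ⟨-, ⟨j, hj, hj'⟩, hd⟩ := hbe
          have : j = i := by
            by_contra hne
            exact hb' j hne ⟨e, hj, hd⟩
          subst this
          exact ⟨⟨hj, hj'⟩, hch.tail ⟨hb, hj, by omega⟩⟩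
      have := h2 i x hi y key.2
      omega

/-- Saturated union. -/
theorem Bd.union (hρ : PM ρ) {d D R : ℕ} {U V : Set Z} (hU : Bd ρ d D U)
    (hV : Bd ρ (D + 2 * d) R V) : Bd ρ d (R + 2 * D + 2 * d) (U ∪ V) := by
  intro x hx y hy
  have key : (y ∈ U ∧ x ∈ U ∧ Relation.ReflTransGen (Stp ρ d U) x y) ∨
      ∃ v0 ∈ V, ∃ v ∈ V, ρ x v0 ≤ D + d ∧
        Relation.ReflTransGen (Stp ρ (D + 2 * d) V) v0 v ∧
        (y = v ∨ ∃ u ∈ U, y ∈ U ∧ ρ v u ≤ d ∧ Relation.ReflTransGen (Stp ρ d U) u y) := by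
    induction hy with
    | refl =>
      rcases hx with hx | hx
      · exact .inl ⟨hx, hx, .refl⟩
      · exact .inr ⟨x, hx, x, hx, by rw [hρ.rfl']; omega, .refl, .inl rfl⟩
    | @tail b e _ hbe ih =>
      obtain ⟨-, he, hd⟩ := hbe
      rcases ih with ⟨hb, hxU, hch⟩ | ⟨v0, hv0, v, hv, hxv, hch, hh⟩
      · rcases he with he | he
        · exact .inl ⟨he, hxU, hch.tail ⟨hb, he, hd⟩⟩
        · refine .inr ⟨e, he, e, he, ?_, .refl, .inl rfl⟩
          have := hU x hxU b hch
          have := hρ.tri x b e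
          omega
      · right
        rcases he with he | he
        · refine ⟨v0, hv0, v, hv, hxv, hch, .inr ?_⟩
          rcases hh with rfl | ⟨u, hu, hb, hvu, hc⟩
          · exact ⟨e, he, he, hd, .refl⟩
          · exact ⟨u, hu, he, hvu, hc.tail ⟨hb, he, hd⟩⟩
        · refine ⟨v0, hv0, e, he, hxv, hch.tail ⟨hv, he, ?_⟩, .inl rfl⟩
          rcases hh with rfl | ⟨u, hu, hb, hvu, hc⟩
          · omega
          · have := hU u hu b hc
            have := hρ.tri v u e
            have := hρ.tri u b e
            omega
  rcases key with ⟨_, hxU, hch⟩ | ⟨v0, hv0, v, hv, hxv, hch, hh⟩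
  · have := hU x hxU y hch
    omega
  · have h1 := hV v0 hv0 v hch
    have h2 := hρ.tri x v0 y
    have h3 := hρ.tri v0 v y
    rcases hh with rfl | ⟨u, hu, hb, hvu, hc⟩
    · omega
    · have := hU u hu y hc
      have := hρ.tri v u y
      omega

/-- From the set-family definition to chains. -/
theorem AD.of_asdim {Z : Type*} {ρ : Z → Z → ℕ} {A : Set Z} {n : ℕ}
    (h : ASDimLEdist (fun a b : A => (ρ a b : ℝ)) n) : AD ρ n A := by
  intro d
  obtain ⟨𝔘, h1, h2⟩ := h (d + 1) (by positivity)
  choose R hR using fun i => (h1 i).1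
  obtain ⟨R', hR'⟩ : ∃ R' : ℕ, ∀ i, R i ≤ R' := by
    refine ⟨Finset.univ.sup fun i => ⌈R i⌉₊, fun i => (Nat.le_ceil _).trans ?_⟩
    exact_mod_cast Finset.le_sup (f := fun i => ⌈R i⌉₊) (Finset.mem_univ i)
  refine ⟨R', fun i => {x | ∃ U ∈ 𝔘 i, ∃ hx : x ∈ A, (⟨x, hx⟩ : A) ∈ U}, ?_, ?_⟩
  · intro x hx
    obtain ⟨i, U, hU, hxU⟩ := h2 ⟨x, hx⟩
    exact ⟨i, U, hU, hx, hxU⟩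
  · rintro i x ⟨U, hU, hxA, hxU⟩ y hy
    have key : ∃ hy : y ∈ A, (⟨y, hy⟩ : A) ∈ U := by
      induction hy with
      | refl => exact ⟨hxA, hxU⟩
      | @tail b e _ hbe ih =>
        obtain ⟨hbA, hbU⟩ := ih
        obtain ⟨-, ⟨V, hV, heA, heV⟩, hd⟩ := hbe
        have : U = V := by
          by_contra hne
          have h3 := (h1 i).2 U hU V hV hne _ hbU _ heV
          have h4 : (ρ b e : ℝ) ≤ d := by exact_mod_cast hd
          simp only at h3
          linarith
        subst this
        exact ⟨heA, heV⟩
    obtain ⟨hyA, hyU⟩ := key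
    have h5 : (ρ x y : ℝ) ≤ R' := (hR i U hU _ hxU _ hyU).trans (hR' i)
    exact_mod_cast h5

/-- From chains to the set-family definition. -/
theorem AD.to_asdim {Z : Type*} {ρ : Z → Z → ℕ} (hρ : PM ρ) {n : ℕ}
    (h : AD ρ n (Set.univ : Set Z)) : ASDimLEdist (fun a b : Z => (ρ a b : ℝ)) n := by
  intro d _
  obtain ⟨R, D, h1, h2⟩ := h ⌈d⌉₊
  have hsym : ∀ i x y, Relation.ReflTransGen (Stp ρ ⌈d⌉₊ (D i)) x y →
      Relation.ReflTransGen (Stp ρ ⌈d⌉₊ (D i)) y x := by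
    intro i x y h
    induction h with
    | refl => exact .refl
    | tail _ h2 ih =>
      obtain ⟨hx, hy, hd⟩ := h2
      exact Relation.ReflTransGen.head ⟨hy, hx, by rw [hρ.symm']; exact hd⟩ ih
  refine ⟨fun i => {U | ∃ x ∈ D i, U = {y | Relation.ReflTransGen (Stp ρ ⌈d⌉₊ (D i)) x y}},
    fun i => ⟨⟨((R + R : ℕ) : ℝ), ?_⟩, ?_⟩, ?_⟩
  · rintro U ⟨x, hx, rfl⟩ y hy z hz
    have a := h2 i x hx y hy
    have b := h2 i x hx z hz
    have c := hρ.tri y x z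
    have e := hρ.symm' x y
    have : ρ y z ≤ R + R := by omega
    exact Nat.cast_le.mpr this
  · rintro U ⟨x, hx, rfl⟩ V ⟨x', hx', rfl⟩ hne y hy z hz
    by_contra hlt
    push Not at hlt
    have memD : ∀ {a b}, a ∈ D i → Relation.ReflTransGen (Stp ρ ⌈d⌉₊ (D i)) a b → b ∈ D i := by
      intro a b ha hab
      rcases Relation.ReflTransGen.cases_tail hab with rfl | ⟨c, _, hc⟩
      · exact ha
      · exact hc.2.1
    have hyz : Stp ρ ⌈d⌉₊ (D i) y z := by
      refine ⟨memD hx hy, memD hx' hz, ?_⟩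
      have := hlt.le.trans (Nat.le_ceil d)
      exact_mod_cast this
    have hxx' : Relation.ReflTransGen (Stp ρ ⌈d⌉₊ (D i)) x x' :=
      (Relation.ReflTransGen.tail hy hyz).trans
        (hsym i _ _ hz)
    apply hne
    ext w
    constructor
    · intro hw
      exact (hsym i _ _ hxx').trans hw
    · intro hw
      exact hxx'.trans hw
  · intro z
    obtain ⟨i, hi⟩ := h1 z trivial
    exact ⟨i, _, ⟨z, hi, rfl⟩, .refl⟩

section Tree

variable {X : Type*} {T : SimpleGraph X}

theorem parent_unique (hT : T.IsTree) (o : X) {x y z : X} (hy : T.Adj x y) (hz : T.Adj x z)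
    (hxy : T.dist o x = T.dist o y + 1) (hxz : T.dist o x = T.dist o z + 1) : y = z := by
  obtain ⟨p, hp⟩ := hT.connected.exists_walk_length_eq_dist o y
  obtain ⟨q, hq⟩ := hT.connected.exists_walk_length_eq_dist o z
  have h1 : (p.concat hy.symm).IsPath :=
    SimpleGraph.Walk.isPath_of_length_eq_dist _ (by rw [SimpleGraph.Walk.length_concat]; omega)
  have h2 : (q.concat hz.symm).IsPath :=
    SimpleGraph.Walk.isPath_of_length_eq_dist _ (by rw [SimpleGraph.Walk.length_concat]; omega)
  have h3 := (hT.existsUnique_path o x).unique h1 h2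
  have h4 := congrArg SimpleGraph.Walk.penultimate h3
  simpa using h4

theorem exists_parent (hT : T.IsTree) (o : X) {x : X} (hx : T.dist o x ≠ 0) :
    ∃ y, T.Adj x y ∧ T.dist o x = T.dist o y + 1 := by
  obtain ⟨p, hp⟩ := hT.connected.exists_walk_length_eq_dist x o
  rw [SimpleGraph.dist_comm] at hp
  cases p with
  | nil => simp at hx
  | @cons _ y _ h q =>
    refine ⟨y, h, ?_⟩
    have h1 := SimpleGraph.dist_le q
    rw [SimpleGraph.dist_comm] at h1
    rw [SimpleGraph.Walk.length_cons] at hp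
    rcases hT.dist_eq_dist_add_one_of_adj o h with h2 | h2 <;> omega

theorem exists_anc (hT : T.IsTree) (o : X) : ∃ a : ℕ → X → X,
    (∀ k x, T.dist o x ≤ k → a k x = x) ∧
    (∀ k x y, T.Adj x y → k ≤ T.dist o x → k ≤ T.dist o y → a k x = a k y) ∧
    (∀ k x, T.dist x (a k x) ≤ T.dist o x - k) := by
  classical
  let p : X → X := fun x => if h : T.dist o x ≠ 0 then (exists_parent hT o h).choose else x
  have hp : ∀ x, T.dist o x ≠ 0 → T.Adj x (p x) ∧ T.dist o x = T.dist o (p x) + 1 := by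
    intro x hx
    simp only [p, dif_pos hx]
    exact (exists_parent hT o hx).choose_spec
  have aux : ∀ k x y, T.Adj x y → k ≤ T.dist o y → T.dist o x = T.dist o y + 1 →
      p^[T.dist o x - k] x = p^[T.dist o y - k] y := by
    intro k x y hxy hk h
    have h1 := hp x (by omega)
    have h2 : y = p x := parent_unique hT o hxy h1.1 h h1.2
    have h3 : T.dist o x - k = (T.dist o y - k) + 1 := by omega
    rw [h3, Function.iterate_succ_apply, ← h2]
  refine ⟨fun k x => p^[T.dist o x - k] x, ?_, ?_, ?_⟩
  · intro k x h
    simp [Nat.sub_eq_zero_of_le h]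
  · intro k x y hxy hx hy
    rcases hT.dist_eq_dist_add_one_of_adj o hxy with h | h
    · exact aux k x y hxy hy h
    · exact (aux k y x hxy.symm hx h).symm
  · intro k x
    simp only
    generalize hm : T.dist o x - k = m
    induction m generalizing x with
    | zero => simp
    | succ m ih =>
      have h1 := hp x (by omega)
      have h2 := ih (p x) (by omega)
      rw [Function.iterate_succ_apply]
      have h3 := hT.connected.dist_triangle (u := x) (v := p x) (w := p^[m] (p x))
      have h4 : T.dist x (p x) = 1 := SimpleGraph.dist_eq_one_iff_adj.mpr h1.1
      omega

theorem anc_of_dist (hT : T.IsTree) (o : X) {a : ℕ → X → X}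
    (ha : ∀ k x y, T.Adj x y → k ≤ T.dist o x → k ≤ T.dist o y → a k x = a k y)
    {k M : ℕ} {x y : X} (hk : k = 0 ∨ k + M ≤ T.dist o x) (hxy : T.dist x y ≤ M) :
    a k x = a k y := by
  obtain ⟨p, hp⟩ := hT.connected.exists_walk_length_eq_dist x y
  rw [← hp] at hxy
  clear hp
  induction p generalizing M with
  | nil => rfl
  | @cons u v w h q ih =>
    rw [SimpleGraph.Walk.length_cons] at hxy
    have h1 := hT.dist_eq_dist_add_one_of_adj o h
    refine (ha k u v h (by omega) (by omega)).trans (ih (M := M - 1) ?_ (by omega))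
    omega

end Tree

section Word

variable {Γ : Type*} [Group Γ] {S : Set Γ}

theorem wd_nonempty (hgen : Subgroup.closure S = ⊤) (hsym : ∀ s ∈ S, s⁻¹ ∈ S) (g h : Γ) :
    {n : ℕ | ∃ l : List Γ, l.length = n ∧ (∀ s ∈ l, s ∈ S) ∧ l.prod = g⁻¹ * h}.Nonempty := by
  have h1 : g⁻¹ * h ∈ Subgroup.closure S := by rw [hgen]; trivial
  rw [← Subgroup.mem_toSubmonoid, Subgroup.closure_toSubmonoid] at h1
  obtain ⟨l, hl, hp⟩ := Submonoid.exists_list_of_mem_closure h1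
  refine ⟨l.length, l, rfl, ?_, hp⟩
  intro s hs
  rcases hl s hs with h2 | h2
  · exact h2
  · simpa using hsym _ h2

theorem wd_list (hgen : Subgroup.closure S = ⊤) (hsym : ∀ s ∈ S, s⁻¹ ∈ S) (g h : Γ) :
    ∃ l : List Γ, l.length = wordDist S g h ∧ (∀ s ∈ l, s ∈ S) ∧ g * l.prod = h := by
  obtain ⟨l, h1, h2, h3⟩ := Nat.sInf_mem (wd_nonempty hgen hsym g h)
  exact ⟨l, h1, h2, by rw [h3]; group⟩

theorem wd_le {l : List Γ} (hl : ∀ s ∈ l, s ∈ S) (g h : Γ) (hh : g * l.prod = h) :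
    wordDist S g h ≤ l.length :=
  Nat.sInf_le ⟨l, rfl, hl, by rw [← hh]; group⟩

theorem wd_left (k g h : Γ) : wordDist S (k * g) (k * h) = wordDist S g h := by
  simp [wordDist, mul_assoc]

theorem wd_pm (hgen : Subgroup.closure S = ⊤) (hsym : ∀ s ∈ S, s⁻¹ ∈ S) :
    PM (wordDist S) := by
  have hs : ∀ x y, wordDist S x y ≤ wordDist S y x := by
    intro x y
    obtain ⟨l, h1, h2, h3⟩ := wd_list hgen hsym y x
    rw [← h1, ← List.length_reverse, ← List.length_map (f := fun s : Γ => s⁻¹)]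
    apply wd_le
    · intro s hs
      simp only [List.mem_map, List.mem_reverse] at hs
      obtain ⟨t, ht, rfl⟩ := hs
      exact hsym _ (h2 t ht)
    · rw [List.map_reverse, ← List.prod_inv_reverse, ← h3]
      group
  refine ⟨fun x => ?_, fun x y => le_antisymm (hs x y) (hs y x), fun x y z => ?_⟩
  · have := wd_le (S := S) (l := []) (by simp) x x (by simp)
    simpa using this
  · obtain ⟨l, h1, h2, h3⟩ := wd_list hgen hsym x y
    obtain ⟨l', h1', h2', h3'⟩ := wd_list hgen hsym y z
    rw [← h1, ← h1', ← List.length_append]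
    apply wd_le
    · intro s hs
      rcases List.mem_append.mp hs with h | h
      · exact h2 s h
      · exact h2' s h
    · rw [List.prod_append, ← mul_assoc, h3, h3']

theorem wd_path (hgen : Subgroup.closure S = ⊤) (hsym : ∀ s ∈ S, s⁻¹ ∈ S) {α : Type*}
    (φ : Γ → α) {r : ℕ} {g h : Γ} (hr : wordDist S g h ≤ r)
    (hφ : ∀ g', wordDist S g g' ≤ r → ∀ s ∈ S, φ g' = φ (g' * s)) : φ g = φ h := by
  obtain ⟨l, h1, h2, rfl⟩ := wd_list hgen hsym g h
  rw [← h1] at hr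
  clear h1
  induction l using List.reverseRecOn with
  | nil => simp
  | append_singleton l s ih =>
    rw [List.length_append] at hr
    have h2' : ∀ t ∈ l, t ∈ S := fun t ht => h2 t (by simp [ht])
    rw [ih h2' (by omega), hφ (g * l.prod) _ s (h2 s (by simp))]
    · simp [mul_assoc]
    · exact (wd_le h2' _ _ rfl).trans (by omega)

theorem Bd.translate {d R : ℕ} {D : Set Γ} (h : Bd (wordDist S) d R D) (k : Γ) :
    Bd (wordDist S) d R {x | k⁻¹ * x ∈ D} := by
  intro x hx y hy
  rw [← wd_left k⁻¹]
  apply h _ hx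
  refine Relation.ReflTransGen.lift (fun z => k⁻¹ * z) ?_ _ _ hy
  rintro a b ⟨ha, hb, hd⟩
  exact ⟨ha, hb, by rw [wd_left]; exact hd⟩

theorem Cov.translate {n d R : ℕ} {A A' : Set Γ} (h : Cov (wordDist S) n d R A) (k : Γ)
    (hA : ∀ x ∈ A', k⁻¹ * x ∈ A) : Cov (wordDist S) n d R A' := by
  obtain ⟨D, h1, h2⟩ := h
  exact ⟨fun i => {x | k⁻¹ * x ∈ D i}, fun x hx => h1 _ (hA x hx), fun i => (h2 i).translate k⟩

end Word

section Action

variable {Γ : Type*} [Group Γ] {S : Finset Γ} {X : Type*} {T : SimpleGraph X} [MulAction Γ X]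

theorem dist_smul_le (hT : T.IsTree) (hiso : ∀ (g : Γ) (u v : X), T.Adj u v ↔ T.Adj (g • u) (g • v))
    (g : Γ) (u v : X) : T.dist (g • u) (g • v) ≤ T.dist u v := by
  obtain ⟨p, hp⟩ := hT.connected.exists_walk_length_eq_dist u v
  let f : T →g T := ⟨fun x => g • x, fun {a b} h => (hiso g a b).1 h⟩
  have := SimpleGraph.dist_le (p.map f)
  rw [SimpleGraph.Walk.length_map, hp] at this
  exact this

theorem dist_smul (hT : T.IsTree) (hiso : ∀ (g : Γ) (u v : X), T.Adj u v ↔ T.Adj (g • u) (g • v))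
    (g : Γ) (u v : X) : T.dist (g • u) (g • v) = T.dist u v := by
  apply le_antisymm (dist_smul_le hT hiso g u v)
  simpa using dist_smul_le hT hiso g⁻¹ (g • u) (g • v)

theorem exists_lip (hgen : Subgroup.closure (S : Set Γ) = ⊤) (hsym : ∀ s ∈ (S : Set Γ), s⁻¹ ∈ (S : Set Γ))
    (hT : T.IsTree) (hiso : ∀ (g : Γ) (u v : X), T.Adj u v ↔ T.Adj (g • u) (g • v)) (o : X) :
    ∃ L : ℕ, ∀ g h : Γ, T.dist (g • o) (h • o) ≤ L * wordDist (S : Set Γ) g h := by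
  refine ⟨S.sup fun s => T.dist o (s • o), fun g h => ?_⟩
  set L := S.sup fun s => T.dist o (s • o) with hL
  obtain ⟨l, h1, h2, rfl⟩ := wd_list hgen hsym g h
  rw [← h1]
  clear h1
  induction l using List.reverseRecOn with
  | nil => simp
  | append_singleton l s ih =>
    have h3 := ih (fun t ht => h2 t (by simp [ht]))
    have h4 : T.dist o (s • o) ≤ L :=
      Finset.le_sup (f := fun s => T.dist o (s • o)) (by simpa using h2 s (by simp))
    have h5 := hT.connected.dist_triangle (u := g • o) (v := (g * l.prod) • o)
      (w := (g * (l ++ [s]).prod) • o)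
    have h6 : T.dist ((g * l.prod) • o) ((g * (l ++ [s]).prod) • o) = T.dist o (s • o) := by
      rw [← dist_smul hT hiso (g * l.prod) o (s • o)]
      simp [mul_assoc, mul_smul]
    simp only [List.length_append, List.length_singleton, mul_add, mul_one]
    omega

theorem exists_fund (S : Finset Γ) (hT : T.IsTree) (o : X) : ∃ F : Finset X, o ∈ F ∧ (∀ s ∈ S, s • o ∈ F) ∧
    ∀ u ∈ F, ∃ w : T.Walk o u, ∀ z ∈ w.support, z ∈ F := by
  classical
  have hw : ∀ x : X, Nonempty (T.Walk o x) := fun x => hT.connected.preconnected o x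
  let w : ∀ x : X, T.Walk o x := fun x => (hw x).some
  refine ⟨insert o (S.biUnion fun s => (w (s • o)).support.toFinset), by simp, ?_, ?_⟩
  · intro s hs
    simp only [Finset.mem_insert, Finset.mem_biUnion, List.mem_toFinset]
    exact .inr ⟨s, hs, SimpleGraph.Walk.end_mem_support _⟩
  · intro u hu
    simp only [Finset.mem_insert, Finset.mem_biUnion, List.mem_toFinset] at hu ⊢
    rcases hu with rfl | ⟨s, hs, hu⟩
    · exact ⟨.nil, by simp⟩
    · refine ⟨(w (s • o)).takeUntil u hu, fun z hz => .inr ⟨s, hs, ?_⟩⟩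
      exact SimpleGraph.Walk.support_takeUntil_subset_support _ hu hz

/-- A function locally constant on `g F` is constant on `g F`. -/
theorem const_on_fund {o : X} {F : Finset X} (φ : X → X) (g : Γ)
    (hφ : ∀ u ∈ F, ∀ v ∈ F, T.Adj u v → φ (g • u) = φ (g • v))
    {u : X} (w : T.Walk o u) (hw : ∀ z ∈ w.support, z ∈ F) : φ (g • o) = φ (g • u) := by
  induction w with
  | nil => rfl
  | @cons a b c h q ih =>
    have h1 : ∀ z ∈ q.support, z ∈ F := fun z hz => hw z (by simp [hz])
    exact (hφ a (hw a (by simp)) b (h1 b (by simp)) h).trans (ih h1)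

/-- Fibres. -/
theorem AD_fibre (hgen : Subgroup.closure (S : Set Γ) = ⊤)
    (hsym : ∀ s ∈ (S : Set Γ), s⁻¹ ∈ (S : Set Γ)) (n : ℕ)
    (hstab : ∀ x : X, ASDimLEdist
      (fun a b : MulAction.stabilizer Γ x =>
        (wordDist (S : Set Γ) (a : Γ) (b : Γ) : ℝ)) n) (F : Finset X) (y : X) :
    AD (wordDist (S : Set Γ)) n {g : Γ | g⁻¹ • y ∈ F} := by
  classical
  have hρ := wd_pm hgen hsym
  have h1 : AD (wordDist (S : Set Γ)) n (MulAction.stabilizer Γ y : Set Γ) :=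
    AD.of_asdim (hstab y)
  let k : X → Γ := fun z => if h : ∃ g : Γ, g • z = y then h.choose else 1
  have hk : ∀ z, (∃ g : Γ, g • z = y) → k z • z = y := by
    intro z hz
    simp only [k, dif_pos hz]
    exact hz.choose_spec
  refine (h1.nb hρ (c := F.sup fun z => wordDist (S : Set Γ) (k z) 1)).mono ?_
  intro g hg
  have hz : k (g⁻¹ • y) • (g⁻¹ • y) = y := hk _ ⟨g, by simp⟩
  refine ⟨g * (k (g⁻¹ • y))⁻¹, ?_, ?_⟩
  · rw [SetLike.mem_coe, MulAction.mem_stabilizer_iff, mul_smul]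
    have h2 : (k (g⁻¹ • y))⁻¹ • y = g⁻¹ • y := by rw [inv_smul_eq_iff, hz]
    rw [h2, smul_inv_smul]
  · refine le_trans (le_of_eq ?_) (Finset.le_sup (f := fun z => wordDist (S : Set Γ) (k z) 1) hg)
    rw [← wd_left (g * (k (g⁻¹ • y))⁻¹) (k (g⁻¹ • y)) 1]
    simp

theorem cov_fibre_unif (hgen : Subgroup.closure (S : Set Γ) = ⊤)
    (hsym : ∀ s ∈ (S : Set Γ), s⁻¹ ∈ (S : Set Γ)) (n : ℕ)
    (hstab : ∀ x : X, ASDimLEdist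
      (fun a b : MulAction.stabilizer Γ x =>
        (wordDist (S : Set Γ) (a : Γ) (b : Γ) : ℝ)) n) (F : Finset X) (d : ℕ) :
    ∃ R, ∀ y : X, Cov (wordDist (S : Set Γ)) n d R {g : Γ | g⁻¹ • y ∈ F} := by
  choose R hR using fun y => AD_fibre hgen hsym n hstab F y d
  refine ⟨F.sup R, fun y => ?_⟩
  by_cases h : ∃ g : Γ, g⁻¹ • y ∈ F
  · obtain ⟨g, hg⟩ := h
    refine ((hR (g⁻¹ • y)).mono (Finset.le_sup hg) subset_rfl).translate g ?_
    intro x hx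
    simpa [smul_smul, mul_assoc] using hx
  · exact ⟨fun _ => ∅, fun x hx => (h ⟨x, hx⟩).elim, fun i x hx => hx.elim⟩

/-- Preimages of balls. -/
theorem AD_ball (hgen : Subgroup.closure (S : Set Γ) = ⊤)
    (hsym : ∀ s ∈ (S : Set Γ), s⁻¹ ∈ (S : Set Γ))
    (hT : T.IsTree) (hiso : ∀ (g : Γ) (u v : X), T.Adj u v ↔ T.Adj (g • u) (g • v)) (n : ℕ)
    (hstab : ∀ x : X, ASDimLEdist
      (fun a b : MulAction.stabilizer Γ x =>
        (wordDist (S : Set Γ) (a : Γ) (b : Γ) : ℝ)) n)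
    (o : X) {F : Finset X} (hSF : ∀ s ∈ S, s • o ∈ F)
    (hF : ∀ u ∈ F, ∃ w : T.Walk o u, ∀ z ∈ w.support, z ∈ F) (R : ℕ) :
    AD (wordDist (S : Set Γ)) n {g : Γ | ∃ v, g⁻¹ • v ∈ F ∧ T.dist o v ≤ R} := by
  have hρ := wd_pm hgen hsym
  obtain ⟨a, ha1, ha2, -⟩ := exists_anc hT o
  induction R with
  | zero =>
    refine (AD_fibre hgen hsym n hstab F o).mono ?_
    rintro g ⟨v, hv, hv0⟩
    have : o = v := by
      rw [← hT.connected.dist_eq_zero_iff]; omega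
    subst this
    exact hv
  | succ R ih =>
    intro d
    obtain ⟨D, hD⟩ := cov_fibre_unif hgen hsym n hstab F d
    choose U hU1 hU2 using hD
    set Y := nb (wordDist (S : Set Γ)) d {g : Γ | ∃ v, g⁻¹ • v ∈ F ∧ T.dist o v ≤ R} with hY
    obtain ⟨R', V, hV1, hV2⟩ := (ih.nb hρ (c := d)) (D + 2 * d)
    have sep : ∀ g h : Γ, ∀ v v' : X, g ∉ Y → wordDist (S : Set Γ) g h ≤ d → g⁻¹ • v ∈ F →
        h⁻¹ • v' ∈ F → T.dist o v = R + 1 → T.dist o v' = R + 1 → v = v' := by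
      intro g h v v' hg hgh hv hv' hvR hvR'
      have far : ∀ g', wordDist (S : Set Γ) g g' ≤ d → ∀ u ∈ F, R + 1 ≤ T.dist o (g' • u) := by
        intro g' hg' u hu
        by_contra hlt
        exact hg ⟨g', ⟨g' • u, by simpa using hu, by omega⟩, hg'⟩
      have cst : ∀ g', wordDist (S : Set Γ) g g' ≤ d → ∀ u ∈ F,
          a (R + 1) (g' • o) = a (R + 1) (g' • u) := by
        intro g' hg' u hu
        obtain ⟨w, hw⟩ := hF u hu
        refine const_on_fund (a (R + 1)) g' ?_ w hw
        intro x hx y hy hxy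
        exact ha2 _ _ _ ((hiso g' x y).1 hxy) (far g' hg' x hx) (far g' hg' y hy)
      have h1 : a (R + 1) (g • o) = a (R + 1) (h • o) := by
        refine wd_path hgen hsym (fun g => a (R + 1) (g • o)) hgh ?_
        intro g' hg' s hs
        have := cst g' hg' (s • o) (hSF s hs)
        simpa [mul_smul] using this
      have h2 := cst g (by rw [hρ.rfl']; omega) _ hv
      have h3 := cst h hgh _ hv'
      rw [smul_inv_smul, ha1 _ v hvR.le] at h2
      rw [smul_inv_smul, ha1 _ v' hvR'.le] at h3
      rw [← h2, ← h3, h1]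
    refine ⟨R' + 2 * D + 2 * d, fun i => {g | g ∉ Y ∧ ∃ v, g⁻¹ • v ∈ F ∧ T.dist o v = R + 1 ∧
      g ∈ U v i} ∪ V i, ?_, ?_⟩
    · rintro g ⟨v, hv, hvR⟩
      by_cases hgY : g ∈ Y
      · obtain ⟨i, hi⟩ := hV1 g hgY
        exact ⟨i, .inr hi⟩
      · have hvR' : T.dist o v = R + 1 := by
          by_contra hne
          exact hgY ⟨g, ⟨v, hv, by omega⟩, by rw [hρ.rfl']; omega⟩
        obtain ⟨i, hi⟩ := hU1 v g hv
        exact ⟨i, .inl ⟨hgY, v, hv, hvR', hi⟩⟩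
    · intro i
      refine Bd.union hρ ?_ (hV2 i)
      rintro x ⟨hxY, v, hv, hvR, hxU⟩ y hy
      have key : (y ∉ Y ∧ y⁻¹ • v ∈ F ∧ y ∈ U v i) ∧
          Relation.ReflTransGen (Stp (wordDist (S : Set Γ)) d (U v i)) x y := by
        induction hy with
        | refl => exact ⟨⟨hxY, hv, hxU⟩, .refl⟩
        | @tail b e _ hbe ih =>
          obtain ⟨⟨hbY, hbv, hbU⟩, hch⟩ := ih
          obtain ⟨-, ⟨heY, v', hv', hvR', heU⟩, hd⟩ := hbe
          have : v = v' := sep b e v v' hbY hd hbv hv' hvR hvR'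
          subst this
          exact ⟨⟨heY, hv', heU⟩, hch.tail ⟨hbU, heU, hd⟩⟩
      exact hU2 v i x hxU y key.2

/-- Arithmetic of the annuli. -/
theorem annulus_div {N i t : ℕ} (hi : i < N) (ht : t % N ≠ i) :
    ∃ r, 1 ≤ r ∧ r < N ∧ t + N = N * ((t + N - i) / N) + r + i := by
  have h1 := Nat.div_add_mod (t + N - i) N
  have h2 := Nat.mod_lt (t + N - i) (show 0 < N by omega)
  refine ⟨(t + N - i) % N, ?_, h2, by omega⟩
  by_contra h3
  have h4 : (t + N - i) % N = 0 := by omega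
  apply ht
  rw [h4] at h1
  have h5 : t + N = i + N * ((t + N - i) / N) := by omega
  have h6 : (t + N) % N = i := by
    rw [h5, Nat.add_mul_mod_self_left, Nat.mod_eq_of_lt hi]
  simpa using h6

theorem annulus_arith {N w i p q : ℕ} (hi : i < N) (hw : 0 < w)
    (hp : (p / w) % N ≠ i) (hq : (q / w) % N ≠ i) (hpq : p ≤ q + w) (hqp : q ≤ p + w) :
    (p / w + N - i) / N = (q / w + N - i) / N := by
  have h1 : p / w ≤ q / w + 1 := by
    rw [← Nat.add_div_right _ hw]; exact Nat.div_le_div_right hpq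
  have h2 : q / w ≤ p / w + 1 := by
    rw [← Nat.add_div_right _ hw]; exact Nat.div_le_div_right hqp
  obtain ⟨r, hr1, hr2, hr⟩ := annulus_div hi hp
  obtain ⟨s, hs1, hs2, hs⟩ := annulus_div hi hq
  generalize (p / w + N - i) / N = A at *
  generalize (q / w + N - i) / N = B at *
  rcases lt_trichotomy A B with h | h | h
  · have := Nat.mul_le_mul_left N (show A + 1 ≤ B from h)
    rw [mul_add] at this
    omega
  · exact h
  · have := Nat.mul_le_mul_left N (show B + 1 ≤ A from h)
    rw [mul_add] at this
    omega

theorem annulus_low {N w i p : ℕ} (hi : i < N) (hp : (p / w) % N ≠ i) :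
    w * (N * ((p / w + N - i) / N) - N) = 0 ∨
      w * (N * ((p / w + N - i) / N) - N) + w ≤ p := by
  obtain ⟨r, hr1, hr2, hr⟩ := annulus_div hi hp
  generalize N * ((p / w + N - i) / N) = A at *
  by_cases hA : A ≤ N
  · left; simp [Nat.sub_eq_zero_of_le hA]
  · right
    have h1 : A - N + 1 ≤ p / w := by omega
    have h2 := Nat.mul_le_mul_left w h1
    have h3 := Nat.mul_div_le p w
    rw [mul_add] at h2
    omega

theorem annulus_high {N w i p : ℕ} (hi : i < N) (hw : 0 < w) :
    p - w * (N * ((p / w + N - i) / N) - N) ≤ w * (2 * N) := by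
  have h1 := Nat.div_add_mod (p / w + N - i) N
  have h2 := Nat.mod_lt (p / w + N - i) (show 0 < N by omega)
  have h3 := Nat.lt_mul_div_succ p hw
  generalize N * ((p / w + N - i) / N) = A at *
  have h4 : p / w + 1 ≤ (A - N) + 2 * N := by omega
  have h5 := Nat.mul_le_mul_left w h4
  rw [mul_add w (A - N)] at h5
  omega

theorem annulus_last {N i t : ℕ} (hi : i < N) (ht : t % N = N - 1) :
    (t + N - i) / N = (t + N - 0) / N := by
  have h1 := Nat.div_add_mod t N
  rw [ht] at h1
  generalize t / N = A at *
  have e1 : t + N - i = (N - 1 - i) + N * (A + 1) := by rw [mul_add]; omega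
  have e2 : t + N - 0 = (N - 1) + N * (A + 1) := by rw [mul_add]; omega
  have hN : 0 < N := by omega
  rw [e1, e2, Nat.add_mul_div_left _ _ hN, Nat.add_mul_div_left _ _ hN,
    Nat.div_eq_of_lt (by omega), Nat.div_eq_of_lt (by omega)]

end Action

theorem main_aux {Γ : Type*} [Group Γ] (S : Finset Γ)
    (hgen : Subgroup.closure (S : Set Γ) = ⊤) (hsym : ∀ s ∈ (S : Set Γ), s⁻¹ ∈ (S : Set Γ))
    {X : Type*} (T : SimpleGraph X) (hT : T.IsTree)
    [MulAction Γ X]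
    (hiso : ∀ (g : Γ) (u v : X), T.Adj u v ↔ T.Adj (g • u) (g • v))
    (n : ℕ)
    (hstab : ∀ x : X, ASDimLEdist
      (fun a b : MulAction.stabilizer Γ x =>
        (wordDist (S : Set Γ) (a : Γ) (b : Γ) : ℝ)) n) :
    AD (wordDist (S : Set Γ)) (n + 1) (Set.univ : Set Γ) := by
  classical
  have hρ := wd_pm hgen hsym
  intro d
  obtain ⟨o⟩ := hT.connected.nonempty
  obtain ⟨F, hoF, hSF, hF⟩ := exists_fund S hT o
  obtain ⟨L, hL⟩ := exists_lip hgen hsym hT hiso o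
  obtain ⟨a, -, ha2, ha3⟩ := exists_anc hT o
  obtain ⟨N, hN⟩ : ∃ N, N = n + 3 := ⟨_, rfl⟩
  obtain ⟨w, hw⟩ : ∃ w, w = L * d + 1 := ⟨_, rfl⟩
  have hw0 : 0 < w := by omega
  let lv : ℕ → Γ → ℕ := fun i g =>
    w * (N * ((T.dist o (g • o) / w + N - i) / N) - N)
  let lam : ℕ → Γ → X := fun i g => a (lv i g) (g • o)
  let E : ℕ → Set Γ := fun i => {g | (T.dist o (g • o) / w) % N ≠ i}
  have hlam1 : ∀ i g h, i < N → g ∈ E i → h ∈ E i → wordDist (S : Set Γ) g h ≤ d →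
      lam i g = lam i h := by
    intro i g h hi hg hh hgh
    have h1 : T.dist (g • o) (h • o) ≤ w :=
      (hL g h).trans ((Nat.mul_le_mul_left L hgh).trans (by omega))
    have h2 := hT.connected.dist_triangle (u := o) (v := g • o) (w := h • o)
    have h3 := hT.connected.dist_triangle (u := o) (v := h • o) (w := g • o)
    rw [T.dist_comm (u := h • o) (v := g • o)] at h3
    have h4 : lv i g = lv i h := by
      simp only [lv]
      rw [annulus_arith hi hw0 hg hh (by omega) (by omega)]
    simp only [lam]
    rw [← h4]
    exact anc_of_dist hT o ha2 (annulus_low hi hg) h1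
  have hlam2 : ∀ i g, i < N → T.dist (g • o) (lam i g) ≤ w * (2 * N) := by
    intro i g hi
    exact (ha3 _ _).trans (annulus_high hi hw0)
  have hlam3 : ∀ i g, i < N → g ∉ E (N - 1) → lam i g = lam 0 g := by
    intro i g hi hg
    have hg' : (T.dist o (g • o) / w) % N = N - 1 := not_not.mp hg
    simp only [lam, lv]
    rw [annulus_last hi hg']
  have hball := AD_ball hgen hsym hT hiso n hstab o hSF hF (w * (2 * N) + w * (2 * N))
  obtain ⟨D, U, hU1, hU2⟩ := hball.kolm hρ d
  obtain ⟨R, V, hV1, hV2⟩ := hball.kolm hρ (D + 2 * d)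
  let k : X → Γ := fun v => if h : ∃ g : Γ, T.dist (g • o) v ≤ w * (2 * N) then h.choose else 1
  have hk : ∀ v, (∃ g : Γ, T.dist (g • o) v ≤ w * (2 * N)) →
      T.dist (k v • o) v ≤ w * (2 * N) := by
    intro v hv
    simp only [k, dif_pos hv]
    exact hv.choose_spec
  have hmem : ∀ i g, i < N → (k (lam i g))⁻¹ * g ∈
      {g : Γ | ∃ v, g⁻¹ • v ∈ F ∧ T.dist o v ≤ w * (2 * N) + w * (2 * N)} := by
    intro i g hi
    refine ⟨((k (lam i g))⁻¹ * g) • o, by rwa [inv_smul_smul], ?_⟩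
    rw [← dist_smul hT hiso (k (lam i g)), smul_smul, mul_inv_cancel_left]
    have h1 := hlam2 i g hi
    have h2 := hk (lam i g) ⟨g, h1⟩
    have h3 := hT.connected.dist_triangle (u := k (lam i g) • o) (v := lam i g) (w := g • o)
    rw [T.dist_comm (u := lam i g)] at h3
    omega
  refine ⟨R + 2 * D + 2 * d, fun i => {g | g ∈ E i ∧ g ∈ E (N - 1) ∧ (k (lam (N - 1) g))⁻¹ * g ∈ U i} ∪
    {g | g ∉ E (N - 1) ∧ (k (lam 0 g))⁻¹ * g ∈ V i}, ?_, ?_⟩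
  · intro g _
    by_cases hg : g ∈ E (N - 1)
    · obtain ⟨i, j, hij, hi, hj⟩ := hU1 _ (hmem (N - 1) g (by omega))
      by_cases hgi : g ∈ E i
      · exact ⟨i, .inl ⟨hgi, hg, hi⟩⟩
      · refine ⟨j, .inl ⟨?_, hg, hj⟩⟩
        have hgi' : (T.dist o (g • o) / w) % N = i := not_not.mp hgi
        intro hgj
        exact hij (Fin.ext (hgi'.symm.trans hgj))
    · obtain ⟨i, j, hij, hi, hj⟩ := hV1 _ (hmem 0 g (by omega))
      exact ⟨i, .inr ⟨hg, hi⟩⟩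
  · intro i x hx y hy
    have hiN : (i : ℕ) < N := by omega
    have hEi : ∀ g, g ∉ E (N - 1) → g ∈ E i := by
      intro g hg
      have hg' : (T.dist o (g • o) / w) % N = N - 1 := not_not.mp hg
      intro hh
      have := i.2
      omega
    have hsub : ∀ g, g ∈ ({g | g ∈ E i ∧ g ∈ E (N - 1) ∧ (k (lam (N - 1) g))⁻¹ * g ∈ U i} ∪
        {g | g ∉ E (N - 1) ∧ (k (lam 0 g))⁻¹ * g ∈ V i} : Set Γ) → g ∈ E i := by
      rintro g (hg | hg)
      · exact hg.1
      · exact hEi g hg.1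
    let W : Set Γ := {g | lam i g = lam i x}
    have hUW : Bd (wordDist (S : Set Γ)) d D
        {g | g ∈ W ∧ g ∈ E i ∧ g ∈ E (N - 1) ∧ (k (lam (N - 1) g))⁻¹ * g ∈ U i} := by
      rintro x ⟨-, -, hxE, hxD⟩ y hy
      refine ((hU2 i).translate (k (lam (N - 1) x))) x hxD y ?_
      have key : (y ∈ E (N - 1) ∧ lam (N - 1) y = lam (N - 1) x ∧
          (k (lam (N - 1) x))⁻¹ * y ∈ U i) ∧
          Relation.ReflTransGen (Stp (wordDist (S : Set Γ)) d
            {z | (k (lam (N - 1) x))⁻¹ * z ∈ U i}) x y := by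
        induction hy with
        | refl => exact ⟨⟨hxE, rfl, hxD⟩, .refl⟩
        | @tail b e _ hbe ih =>
          obtain ⟨⟨hbE, hbl, hbD⟩, hch⟩ := ih
          obtain ⟨-, ⟨-, -, heE, heD⟩, hd⟩ := hbe
          have h1 := hlam1 (N - 1) b e (by omega) hbE heE hd
          rw [← h1, hbl] at heD
          exact ⟨⟨heE, by rw [← h1, hbl], heD⟩, hch.tail ⟨hbD, heD, hd⟩⟩
      exact key.2
    have hVW : Bd (wordDist (S : Set Γ)) (D + 2 * d) R
        {g | g ∈ W ∧ g ∉ E (N - 1) ∧ (k (lam 0 g))⁻¹ * g ∈ V i} := by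
      have hin : ∀ g, g ∈ ({g | g ∈ W ∧ g ∉ E (N - 1) ∧ (k (lam 0 g))⁻¹ * g ∈ V i} : Set Γ) →
          (k (lam i x))⁻¹ * g ∈ V i := by
        rintro g ⟨hgW, hgE, hgV⟩
        rw [← hlam3 i g hiN hgE, show lam i g = lam i x from hgW] at hgV
        exact hgV
      intro y hy z hz
      refine ((hV2 i).translate (k (lam i x))) y (hin y hy) z ?_
      refine Relation.ReflTransGen.mono ?_ _ _ hz
      rintro b e ⟨hb, he, hd⟩
      exact ⟨hin b hb, hin e he, hd⟩
    have hxW : ∀ g, g ∈ W → g ∈ ({g | g ∈ E i ∧ g ∈ E (N - 1) ∧ (k (lam (N - 1) g))⁻¹ * g ∈ U i} ∪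
        {g | g ∉ E (N - 1) ∧ (k (lam 0 g))⁻¹ * g ∈ V i} : Set Γ) →
        g ∈ ({g | g ∈ W ∧ g ∈ E i ∧ g ∈ E (N - 1) ∧ (k (lam (N - 1) g))⁻¹ * g ∈ U i} ∪
        {g | g ∈ W ∧ g ∉ E (N - 1) ∧ (k (lam 0 g))⁻¹ * g ∈ V i} : Set Γ) := by
      rintro g hgW (hg | hg)
      · exact .inl ⟨hgW, hg⟩
      · exact .inr ⟨hgW, hg⟩
    refine (Bd.union hρ hUW hVW) x (hxW x rfl hx) y ?_
    have key : y ∈ W ∧ Relation.ReflTransGen (Stp (wordDist (S : Set Γ)) d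
        ({g | g ∈ W ∧ g ∈ E i ∧ g ∈ E (N - 1) ∧ (k (lam (N - 1) g))⁻¹ * g ∈ U i} ∪
        {g | g ∈ W ∧ g ∉ E (N - 1) ∧ (k (lam 0 g))⁻¹ * g ∈ V i})) x y := by
      induction hy with
      | refl => exact ⟨rfl, .refl⟩
      | @tail b e _ hbe ih =>
        obtain ⟨hbW, hch⟩ := ih
        obtain ⟨hb, he, hd⟩ := hbe
        have h1 := hlam1 i b e hiN (hsub b hb) (hsub e he) hd
        have heW : e ∈ W := h1.symm.trans hbW
        exact ⟨heW, hch.tail ⟨hxW b hbW hb, hxW e heW he, hd⟩⟩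
    exact key.2

end AsdTree

/-- Assume a finitely generated group `Γ` acts by isometries (simplicial automorphisms)
on a tree `X` with compact (finite) orbit space and all vertex stabilizers `Γ_x` (with
the restricted word metric) satisfy `asdim Γ_x ≤ n`. Then `asdim Γ ≤ n + 1`. -/
theorem asdim_le_of_cocompact_action_on_tree {Γ : Type*} [Group Γ] (S : Finset Γ)
    (hgen : Subgroup.closure (S : Set Γ) = ⊤) (hsym : ∀ s ∈ S, s⁻¹ ∈ S)
    {X : Type*} (T : SimpleGraph X) (hT : T.IsTree)
    [MulAction Γ X]
    (hiso : ∀ (g : Γ) (u v : X), T.Adj u v ↔ T.Adj (g • u) (g • v))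
    (hcompact : Finite (Quotient (MulAction.orbitRel Γ X)))
    (n : ℕ)
    (hstab : ∀ x : X, ASDimLEdist
      (fun a b : MulAction.stabilizer Γ x =>
        (wordDist (S : Set Γ) (a : Γ) (b : Γ) : ℝ)) n) :
    ASDimLEdist (fun g h : Γ => (wordDist (S : Set Γ) g h : ℝ)) (n + 1) := by
  exact AsdTree.AD.to_asdim (AsdTree.wd_pm hgen (fun s hs => hsym s hs))
    (AsdTree.main_aux S hgen (fun s hs => hsym s hs) T hT hiso n hstab)
end

section
/- Let (G,Y) be a finite graph of groups with finitely generated vertex groups satisfying asdim G_v ≤ n for all vertices v. Then the fundamental group satisfies asdim π₁(G,Y,v₀) ≤ n + 1 for any vertex v₀. -/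
open Set

/-! Graph of groups, the group `F(G,Y)`, words of type `c`, and the Bass–Serre tree.
A Serre graph has edge set `E` with an involution `bar` (edge reversal) and terminal
vertex map `t`; the initial vertex of `e` is `t (bar e)`. -/

section GraphOfGroups

variable {V E : Type} (bar : E → E) (t : E → V)
variable (Gv : V → Type) [∀ v, Group (Gv v)]
variable (Ge : E → Type) [∀ e, Group (Ge e)]
variable (φ : ∀ e, Ge e →* Gv (t e)) (inv : ∀ e, Ge e →* Ge (bar e))

/-- The relators defining `F(G,Y)` as a quotient of the free group on the disjoint union
of the elements of the vertex groups and the edges: the multiplication tables of the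
vertex groups, `ȳ = y⁻¹`, and `y φ_y(a) y⁻¹ = φ_ȳ(a)`. -/
def ggRels : Set (FreeGroup ((Σ v : V, Gv v) ⊕ E)) :=
  {x | ∃ (v : V) (a b : Gv v),
      x = FreeGroup.of (Sum.inl ⟨v, a⟩) * FreeGroup.of (Sum.inl ⟨v, b⟩) *
        (FreeGroup.of (Sum.inl ⟨v, a * b⟩))⁻¹} ∪
  {x | ∃ e : E, x = FreeGroup.of (Sum.inr (bar e)) * FreeGroup.of (Sum.inr e)} ∪
  {x | ∃ (e : E) (a : Ge e),
      x = FreeGroup.of (Sum.inr e) * FreeGroup.of (Sum.inl ⟨t e, φ e a⟩) *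
        (FreeGroup.of (Sum.inr e))⁻¹ *
        (FreeGroup.of (Sum.inl ⟨t (bar e), φ (bar e) (inv e a)⟩))⁻¹}

/-- The group `F(G,Y)`. -/
def GGF := PresentedGroup (ggRels bar t Gv Ge φ inv)

noncomputable instance : Group (GGF bar t Gv Ge φ inv) := by
  unfold GGF; infer_instance

/-- The image in `F(G,Y)` of an element of a vertex group. -/
def ofV (v : V) (a : Gv v) : GGF bar t Gv Ge φ inv :=
  PresentedGroup.of (Sum.inl ⟨v, a⟩)

/-- The image in `F(G,Y)` of an edge generator. -/
def ofE (e : E) : GGF bar t Gv Ge φ inv :=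
  PresentedGroup.of (Sum.inr e)

/-- A word of type `c` in `F(G,Y)`: `r₀ y₁ r₁ ⋯ y_n r_n` along an edge path `c` from `u`
to `w`, with `r_i` in the vertex group of the `i`-th vertex of the path. -/
inductive GWord' {V' E' : Type} (bar' : E' → E') (t' : E' → V') (Gv' : V' → Type) :
    V' → V' → Type
  | single (v : V') (r : Gv' v) : GWord' bar' t' Gv' v v
  | cons (e : E') (r : Gv' (t' (bar' e))) {w : V'} (rest : GWord' bar' t' Gv' (t' e) w) :
      GWord' bar' t' Gv' (t' (bar' e)) w

/-- The length `l(c)` of the path underlying a word of type `c`. -/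
def GWord'.len {V' E' : Type} {bar' : E' → E'} {t' : E' → V'} {Gv' : V' → Type}
    {u w : V'} : GWord' bar' t' Gv' u w → ℕ
  | .single _ _ => 0
  | .cons _ _ rest => rest.len + 1

/-- The element of `F(G,Y)` associated to a word of type `c`. -/
noncomputable def GWord'.eval :
    ∀ {u w : V}, GWord' bar t Gv u w → GGF bar t Gv Ge φ inv
  | _, _, .single v r => ofV bar t Gv Ge φ inv v r
  | _, _, .cons e r rest =>
      ofV bar t Gv Ge φ inv (t (bar e)) r * ofE bar t Gv Ge φ inv e *
        GWord'.eval rest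

/-- The canonical image `π_v` of the vertex group `G_v` in `F(G,Y)`. -/
noncomputable def vSub (v : V) : Subgroup (GGF bar t Gv Ge φ inv) :=
  Subgroup.closure (Set.range fun a : Gv v => ofV bar t Gv Ge φ inv v a)

/-- The vertex set of the Bass–Serre tree: the disjoint union over the vertices `v` of
the left cosets of `π_v`. -/
def BSVert : Type :=
  Σ v : V, GGF bar t Gv Ge φ inv ⧸ vSub bar t Gv Ge φ inv v

/-- The Bass–Serre tree (graph): `x π_{i(e)}` is joined to `(x y_e) π_{t(e)}`. -/
def BSGraph : SimpleGraph (BSVert bar t Gv Ge φ inv) :=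
  SimpleGraph.fromRel fun A B => ∃ (e : E) (x : GGF bar t Gv Ge φ inv),
    A = ⟨t (bar e), QuotientGroup.mk x⟩ ∧
    B = ⟨t e, QuotientGroup.mk (x * ofE bar t Gv Ge φ inv e)⟩

end GraphOfGroups

section Coarse

/-- Chains inside `A` with steps of size at most `d`. -/
def CoarseChain {X : Type*} (ρ : X → X → ℕ) (d : ℕ) (A : Set X) : X → X → Prop :=
  Relation.ReflTransGen (fun x y => x ∈ A ∧ y ∈ A ∧ ρ x y ≤ d)

/-- The `d`-components of `A` have diameter at most `R`. -/
def CompBdd {X : Type*} (ρ : X → X → ℕ) (d R : ℕ) (A : Set X) : Prop :=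
  ∀ x y, CoarseChain ρ d A x y → ρ x y ≤ R

/-- `A` is covered by `n+1` sets whose `d`-components are `R`-bounded. -/
def CoarseCov {X : Type*} (ρ : X → X → ℕ) (n d R : ℕ) (A : Set X) : Prop :=
  ∃ C : Fin (n + 1) → Set X, (∀ i, CompBdd ρ d R (C i)) ∧ ∀ x ∈ A, ∃ i, x ∈ C i

/-- The pseudometric laws for an integer valued distance. -/
structure IsDist {X : Type*} (ρ : X → X → ℕ) : Prop where
  self : ∀ x, ρ x x = 0
  symm : ∀ x y, ρ x y = ρ y x
  tri : ∀ x y z, ρ x z ≤ ρ x y + ρ y z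

/-- Closed neighbourhood. -/
def nbd {X : Type*} (ρ : X → X → ℕ) (r : ℕ) (A : Set X) : Set X := {x | ∃ a ∈ A, ρ x a ≤ r}

variable {X : Type*} {ρ : X → X → ℕ}

theorem CoarseChain.mono {d d' : ℕ} {A A' : Set X} (hd : d ≤ d') (hA : A ⊆ A') {x y : X}
    (h : CoarseChain ρ d A x y) : CoarseChain ρ d' A' x y :=
  Relation.ReflTransGen.mono (fun _ _ h => ⟨hA h.1, hA h.2.1, h.2.2.trans hd⟩) _ _ h

theorem CompBdd.mono {d d' R R' : ℕ} {A A' : Set X} (hd : d ≤ d') (hR : R' ≤ R) (hA : A ⊆ A')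
    (h : CompBdd ρ d' R' A') : CompBdd ρ d R A :=
  fun x y hxy => (h x y (hxy.mono hd hA)).trans hR

theorem CompBdd.nbd (hρ : IsDist ρ) {D r R : ℕ} {A : Set X} (h : CompBdd ρ (D + 2 * r) R A) :
    CompBdd ρ D (R + 2 * r) (nbd ρ r A) := by
  intro x y hxy
  have key : x = y ∨ ∃ a b, ρ x a ≤ r ∧ ρ y b ≤ r ∧ a ∈ A ∧ b ∈ A ∧
      CoarseChain ρ (D + 2 * r) A a b := by
    induction hxy with
    | refl => exact Or.inl rfl
    | tail hxy hyz ih =>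
      rename_i y z
      right
      obtain ⟨hy, ⟨c, hc, hzc⟩, hd⟩ := hyz
      rcases ih with rfl | ⟨a, b, hxa, hyb, ha, hb, hab⟩
      · obtain ⟨b, hb, hyb⟩ := hy
        refine ⟨b, c, hyb, hzc, hb, hc, Relation.ReflTransGen.single ⟨hb, hc, ?_⟩⟩
        have := hρ.tri b x c
        have := hρ.tri x z c
        have := hρ.symm b x
        omega
      · refine ⟨a, c, hxa, hzc, ha, hc, hab.tail ⟨hb, hc, ?_⟩⟩
        have := hρ.tri b y c
        have := hρ.tri y z c
        have := hρ.symm b y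
        omega
  rcases key with rfl | ⟨a, b, hxa, hyb, ha, hb, hab⟩
  · simp [hρ.self]
  · have := h a b hab
    have := hρ.tri x a y
    have := hρ.tri a b y
    have := hρ.symm b y
    omega

/-- Decomposition into separated pieces. -/
theorem CompBdd.pieces {Λ : Type*} {d R : ℕ} {A : Set X} (lab : X → Λ)
    (hlab : ∀ x ∈ A, ∀ y ∈ A, ρ x y ≤ d → lab x = lab y)
    (h : ∀ c, CompBdd ρ d R {x | x ∈ A ∧ lab x = c}) : CompBdd ρ d R A := by
  intro x y hxy
  apply h (lab x)
  have : lab y = lab x ∧ CoarseChain ρ d {z | z ∈ A ∧ lab z = lab x} x y := by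
    induction hxy with
    | refl => exact ⟨rfl, Relation.ReflTransGen.refl⟩
    | tail hxy hyz ih =>
      rename_i y z
      have e := hlab _ hyz.1 _ hyz.2.1 hyz.2.2
      exact ⟨e ▸ ih.1, ih.2.tail ⟨⟨hyz.1, ih.1⟩, ⟨hyz.2.1, e ▸ ih.1⟩, hyz.2.2⟩⟩
  exact this.2

/-- Saturated union. -/
theorem CompBdd.union (hρ : IsDist ρ) {d R R' : ℕ} {A B : Set X} (hA : CompBdd ρ d R A)
    (hB : CompBdd ρ (R + 2 * d) R' B) : CompBdd ρ d (R' + 2 * R + 2 * d) (A ∪ B) := by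
  intro x y hxy
  have key : CoarseChain ρ d A x y ∨ ∃ b c, b ∈ B ∧ c ∈ B ∧ ρ x b ≤ R + d ∧
      CoarseChain ρ (R + 2 * d) B b c ∧ (y = c ∨ ∃ a, ρ c a ≤ d ∧ CoarseChain ρ d A a y) := by
    induction hxy with
    | refl => exact Or.inl Relation.ReflTransGen.refl
    | tail hxy hyz ih =>
      rename_i y z
      obtain ⟨hy, hz, hd⟩ := hyz
      rcases ih with ih | ⟨b, c, hb, hc, hxb, hbc, ih⟩
      · by_cases hzB : z ∈ B
        · right
          refine ⟨z, z, hzB, hzB, ?_, Relation.ReflTransGen.refl, Or.inl rfl⟩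
          have := hA _ _ ih
          have := hρ.tri x y z
          omega
        · have hzA : z ∈ A := hz.resolve_right hzB
          by_cases hyA : y ∈ A
          · exact Or.inl (ih.tail ⟨hyA, hzA, hd⟩)
          · right
            have hyB : y ∈ B := hy.resolve_left hyA
            refine ⟨y, y, hyB, hyB, ?_, Relation.ReflTransGen.refl,
              Or.inr ⟨z, hd, Relation.ReflTransGen.refl⟩⟩
            have := hA _ _ ih
            omega
      · right
        by_cases hzB : z ∈ B
        · refine ⟨b, z, hb, hzB, hxb, hbc.tail ⟨hc, hzB, ?_⟩, Or.inl rfl⟩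
          rcases ih with rfl | ⟨a, hca, hay⟩
          · omega
          · have := hA _ _ hay
            have := hρ.tri c a z
            have := hρ.tri a y z
            omega
        · have hzA : z ∈ A := hz.resolve_right hzB
          by_cases hyB : y ∈ B
          · refine ⟨b, y, hb, hyB, hxb, hbc.tail ⟨hc, hyB, ?_⟩,
              Or.inr ⟨z, hd, Relation.ReflTransGen.refl⟩⟩
            rcases ih with rfl | ⟨a, hca, hay⟩
            · simp [hρ.self]
            · have := hA _ _ hay
              have := hρ.tri c a y
              omega
          · have hyA : y ∈ A := hy.resolve_right hyB
            refine ⟨b, c, hb, hc, hxb, hbc, Or.inr ?_⟩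
            rcases ih with rfl | ⟨a, hca, hay⟩
            · exact absurd hc hyB
            · exact ⟨a, hca, hay.tail ⟨hyA, hzA, hd⟩⟩
  rcases key with key | ⟨b, c, hb, hc, hxb, hbc, ih⟩
  · have := hA _ _ key
    omega
  · have h1 := hB _ _ hbc
    have := hρ.tri x b y
    have := hρ.tri b c y
    rcases ih with rfl | ⟨a, hca, hay⟩
    · omega
    · have := hA _ _ hay
      have := hρ.tri c a y
      omega

/-- The Kolmogorov trick. -/
theorem CoarseCov.double (hρ : IsDist ρ) {n d R : ℕ} {A : Set X}
    (h : CoarseCov ρ n (d + 2 * d) R A) :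
    ∃ C : Fin (n + 2) → Set X, (∀ i, CompBdd ρ d (R + 2 * d) (C i)) ∧
      ∀ x ∈ A, ∃ i j, i ≠ j ∧ x ∈ C i ∧ x ∈ C j := by
  obtain ⟨U, hU, hc⟩ := h
  refine ⟨Fin.snoc (α := fun _ => Set X) (fun i => nbd ρ d (U i))
    {x | ∃ i, x ∈ U i ∧ ∀ j, j ≠ i → x ∉ nbd ρ d (U j)}, ?_, ?_⟩
  · intro i
    refine Fin.lastCases ?_ ?_ i
    · rw [Fin.snoc_last]
      intro x y hxy
      have key : x = y ∨ ∃ i, y ∈ U i ∧ CoarseChain ρ (d + 2 * d) (U i) x y := by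
        induction hxy with
        | refl => exact Or.inl rfl
        | tail hxy hyz ih =>
          rename_i y z
          right
          obtain ⟨⟨i, hyi, hi⟩, ⟨j, hzj, hj⟩, hd⟩ := hyz
          have hij : i = j := by
            by_contra hne
            exact hj i hne ⟨y, hyi, by rwa [hρ.symm]⟩
          subst hij
          refine ⟨i, hzj, ?_⟩
          have hs : CoarseChain ρ (d + 2 * d) (U i) y z :=
            Relation.ReflTransGen.single ⟨hyi, hzj, by omega⟩
          rcases ih with rfl | ⟨k, hyk, hk⟩
          · exact hs
          · have : k = i := by
              by_contra hne
              exact hi k hne ⟨y, hyk, by simp [hρ.self]⟩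
            subst this
            exact Relation.ReflTransGen.trans hk hs
      rcases key with rfl | ⟨i, _, hi⟩
      · simp [hρ.self]
      · exact (hU i _ _ hi).trans (by omega)
    · intro i
      rw [Fin.snoc_castSucc]
      exact (hU i).nbd hρ
  · intro x hx
    obtain ⟨i, hi⟩ := hc x hx
    have hi' : x ∈ nbd ρ d (U i) := ⟨x, hi, by simp [hρ.self]⟩
    by_cases hex : ∃ j, j ≠ i ∧ x ∈ nbd ρ d (U j)
    · obtain ⟨j, hj, hxj⟩ := hex
      refine ⟨Fin.castSucc i, Fin.castSucc j, ?_, ?_, ?_⟩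
      · intro h; exact hj (Fin.castSucc_injective _ h).symm
      · rw [Fin.snoc_castSucc]; exact hi'
      · rw [Fin.snoc_castSucc]; exact hxj
    · refine ⟨Fin.castSucc i, Fin.last _, ?_, ?_, ?_⟩
      · exact (Fin.castSucc_lt_last i).ne
      · rw [Fin.snoc_castSucc]; exact hi'
      · rw [Fin.snoc_last]
        exact ⟨i, hi, fun j hj hx => hex ⟨j, hj, hx⟩⟩

end Coarse
section TreePart

/-- A coarse map `f` onto a rooted forest with parent function `par` and height `h`. -/
structure TreeFib {X T : Type*} (ρ : X → X → ℕ) (f : X → T) (par : T → T) (h : T → ℕ) :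
    Prop where
  hpar : ∀ a, h a ≠ 0 → h (par a) + 1 = h a
  hroot : ∀ a, h a = 0 → par a = a
  lip : ∀ x y, h (f x) ≤ h (f y) + ρ x y
  ivp : ∀ Q : X → Prop, ∀ x y, Q x → ¬ Q y → ∃ z z', Q z ∧ ¬ Q z' ∧ ρ x z' ≤ ρ x y ∧
    (f z = f z' ∨ f z = par (f z') ∨ f z' = par (f z))

/-- The ancestor at level `k`. -/
def anc {T : Type*} (par : T → T) (h : T → ℕ) (k : ℕ) (a : T) : T := par^[h a - k] a

/-- The points of `X` lying at depth at most `k` below `τ`. -/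
def cone {X T : Type*} (f : X → T) (par : T → T) (h : T → ℕ) (τ : T) (k : ℕ) : Set X :=
  {x | h τ ≤ h (f x) ∧ h (f x) ≤ h τ + k ∧ anc par h (h τ) (f x) = τ}

variable {X T : Type*} {ρ : X → X → ℕ} {f : X → T} {par : T → T} {h : T → ℕ}

theorem TreeFib.h_iter (H : TreeFib ρ f par h) (j : ℕ) (a : T) : h (par^[j] a) = h a - j := by
  induction j generalizing a with
  | zero => simp
  | succ j ih =>
    rw [Function.iterate_succ_apply, ih]
    by_cases ha : h a = 0
    · rw [H.hroot a ha]; omega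
    · have := H.hpar a ha; omega

theorem TreeFib.h_anc (H : TreeFib ρ f par h) {k : ℕ} {a : T} (hk : k ≤ h a) :
    h (anc par h k a) = k := by
  rw [anc, H.h_iter]; omega

theorem anc_self (a : T) : anc par h (h a) a = a := by simp [anc]

theorem TreeFib.anc_par (H : TreeFib ρ f par h) {k : ℕ} {a : T} (hk : k ≤ h (par a)) :
    anc par h k (par a) = anc par h k a := by
  by_cases ha : h a = 0
  · rw [H.hroot a ha]
  · have := H.hpar a ha
    have e : h a - k = (h (par a) - k) + 1 := by omega
    rw [anc, anc, e, Function.iterate_succ_apply]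

theorem TreeFib.cross (H : TreeFib ρ f par h) {k : ℕ} {x y : X} (hx : k ≤ h (f x))
    (_hy : k ≤ h (f y)) (hne : anc par h k (f x) ≠ anc par h k (f y)) :
    ∃ z, ρ x z ≤ ρ x y ∧ f z = par (anc par h k (f x)) ∧ h (f z) + 1 = k := by
  obtain ⟨z, z', ⟨hz1, hz2⟩, hz', hd, hadj⟩ := H.ivp
    (fun z => k ≤ h (f z) ∧ anc par h k (f z) = anc par h k (f x)) x y ⟨hx, rfl⟩
    (fun hh => hne hh.2.symm)
  rcases hadj with e | e | e
  · rw [← e] at hz'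
    exact absurd ⟨hz1, hz2⟩ hz'
  · exfalso
    apply hz'
    rw [e] at hz1 hz2
    rw [H.anc_par hz1] at hz2
    refine ⟨?_, hz2⟩
    by_cases h0 : h (f z') = 0
    · rwa [H.hroot _ h0] at hz1
    · have := H.hpar _ h0; omega
  · have hlt : h (f z') < k := by
      by_contra hge
      push Not at hge
      apply hz'
      refine ⟨hge, ?_⟩
      rw [e, H.anc_par (e ▸ hge), hz2]
    have h0 : h (f z) ≠ 0 := by omega
    have h1 := H.hpar _ h0
    rw [← e] at h1
    refine ⟨z', hd, ?_, by omega⟩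
    have h2 : h (f z) = k := by omega
    rw [e, ← hz2, ← h2, anc_self]

theorem TreeFib.anc_step (H : TreeFib ρ f par h) {k d : ℕ} {x y : X} (hx : k ≤ h (f x))
    (hy : k ≤ h (f y)) (hd : ρ x y ≤ d) (hk : k = 0 ∨ k + d ≤ h (f x)) :
    anc par h k (f x) = anc par h k (f y) := by
  by_contra hne
  obtain ⟨z, h1, h2, h3⟩ := H.cross hx hy hne
  have := H.lip x z
  omega

theorem TreeFib.cone_cov (hρ : IsDist ρ) (H : TreeFib ρ f par h) {n : ℕ}
    (hfib : ∀ d, ∃ R, ∀ a, CoarseCov ρ n d R (f ⁻¹' {a})) (k : ℕ) :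
    ∀ d, ∃ R, ∀ τ, CoarseCov ρ n d R (cone f par h τ k) := by
  induction k with
  | zero =>
    intro d
    obtain ⟨R, hR⟩ := hfib d
    refine ⟨R, fun τ => ?_⟩
    obtain ⟨C, hC, hc⟩ := hR τ
    refine ⟨C, hC, fun x hx => hc x ?_⟩
    obtain ⟨h1, h2, h3⟩ := hx
    have h4 : h (f x) = h τ := by omega
    rw [← h4, anc_self] at h3
    exact h3
  | succ k ih =>
    intro d
    obtain ⟨R, hR⟩ := hfib d
    obtain ⟨R', hR'⟩ := ih ((R + 2 * d) + 2 * d)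
    choose U hU hUc using hR
    refine ⟨(R' + 2 * d) + 2 * R + 2 * d, fun τ => ?_⟩
    obtain ⟨C, hC, hc⟩ := hR' τ
    set W := cone f par h τ k with hW
    let A : Fin (n + 1) → Set X := fun i =>
      {x | h (f x) = h τ + k + 1 ∧ anc par h (h τ) (f x) = τ ∧ x ∉ nbd ρ d W ∧ x ∈ U (f x) i}
    refine ⟨fun i => A i ∪ nbd ρ d (C i), fun i => ?_, fun x hx => ?_⟩
    · refine CompBdd.union hρ ?_ ((hC i).nbd hρ)
      refine CompBdd.pieces f ?_ ?_
      · rintro x ⟨hx1, hx2, hx3, hx4⟩ y ⟨hy1, hy2, hy3, hy4⟩ hxy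
        by_contra hne
        have ex : anc par h (h τ + k + 1) (f x) = f x := by rw [← hx1, anc_self]
        have ey : anc par h (h τ + k + 1) (f y) = f y := by rw [← hy1, anc_self]
        obtain ⟨z, h1, h2, h3⟩ := H.cross (k := h τ + k + 1) hx1.ge hy1.ge (by rwa [ex, ey])
        rw [ex] at h2
        refine hx3 ⟨z, ⟨by omega, by omega, ?_⟩, by omega⟩
        rw [h2, H.anc_par (by rw [← h2]; omega), hx2]
      · intro c
        refine (hU c i).mono le_rfl le_rfl ?_
        rintro x ⟨⟨hx1, hx2, hx3, hx4⟩, hx5⟩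
        rwa [hx5] at hx4
    · by_cases hxW : x ∈ nbd ρ d W
      · obtain ⟨w, hw, hxw⟩ := hxW
        obtain ⟨i, hi⟩ := hc w hw
        exact ⟨i, Or.inr ⟨w, hi, hxw⟩⟩
      · obtain ⟨h1, h2, h3⟩ := hx
        have hgt : ¬ h (f x) ≤ h τ + k := fun hle =>
          hxW ⟨x, ⟨h1, hle, h3⟩, by simp [hρ.self]⟩
        obtain ⟨i, hi⟩ := hUc (f x) x rfl
        exact ⟨i, Or.inl ⟨by omega, h3, hxW, hi⟩⟩

theorem arith_even {K L d Hx Hy : ℕ} (hK : K = 2 * L) (hd : d < L) (hx : Hx % K < L)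
    (hy : Hy % K < L) (h1 : Hx ≤ Hy + d) (h2 : Hy ≤ Hx + d) : Hx / K = Hy / K := by
  have a := Nat.div_add_mod Hx K
  have b := Nat.div_add_mod Hy K
  rcases lt_trichotomy (Hx / K) (Hy / K) with hlt | he | hlt
  · have := Nat.mul_le_mul_left K (Nat.succ_le_of_lt hlt)
    rw [Nat.mul_succ] at this
    omega
  · exact he
  · have := Nat.mul_le_mul_left K (Nat.succ_le_of_lt hlt)
    rw [Nat.mul_succ] at this
    omega

theorem arith_cut {K c d i Hx Hy : ℕ} (hc : c = (i + 1) * (d + 1)) (hcK : c + d + 1 ≤ K)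
    (hy : (Hy % K) / (d + 1) ≠ i + 1) (h2 : Hy ≤ Hx + d) :
    ¬ ((Hx + K - c) / K < (Hy + K - c) / K) := by
  intro hlt
  have hK : 0 < K := by omega
  set m := (Hx + K - c) / K with hm
  have h3 : Hx + K - c < K * (m + 1) := Nat.lt_mul_div_succ _ hK
  have h4 : K * (m + 1) ≤ Hy + K - c :=
    (Nat.mul_le_mul_left K (Nat.succ_le_of_lt hlt)).trans (Nat.mul_div_le _ _)
  rw [Nat.mul_succ] at h3 h4
  have h5 : Hy % K = Hy - K * m := by
    have : Hy = (Hy - K * m) + K * m := by omega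
    conv_lhs => rw [this]
    rw [Nat.add_mul_mod_self_left, Nat.mod_eq_of_lt (by omega)]
  apply hy
  rw [h5]
  apply Nat.div_eq_of_lt_le
  · rw [← hc]; omega
  · rw [Nat.succ_mul, ← hc]; omega

theorem TreeFib.main (hρ : IsDist ρ) (H : TreeFib ρ f par h) {n : ℕ}
    (hfib : ∀ d, ∃ R, ∀ a, CoarseCov ρ n d R (f ⁻¹' {a})) (d : ℕ) :
    ∃ R, CoarseCov ρ (n + 1) d R univ := by
  set L := (n + 3) * (d + 1) with hL
  set K := 2 * L with hK
  have hcov := H.cone_cov hρ hfib (2 * K)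
  have hdL : d + 1 ≤ L := by rw [hL]; nlinarith
  have hKpos : 0 < K := by omega
  obtain ⟨R1, hR1⟩ := hcov (d + 2 * d)
  obtain ⟨R2, hR2⟩ := hcov (((R1 + 2 * d) + 2 * d) + 2 * ((R1 + 2 * d) + 2 * d))
  have hR1' := fun τ => (hR1 τ).double hρ
  have hR2' := fun τ => (hR2 τ).double hρ
  choose C1 hC1 hc1 using hR1'
  choose C2 hC2 hc2 using hR2'
  let hh : X → ℕ := fun x => h (f x)
  let lev : X → T := fun x => anc par h (K * (hh x / K - 1)) (f x)
  let sig : X → T := fun x => anc par h (K * (hh x / K)) (f x)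
  let A : Fin (n + 2) → Set X := fun i =>
    {x | hh x % K < L ∧ (hh x % K) / (d + 1) ≠ i + 1 ∧ x ∈ C1 (lev x) i}
  let B : Fin (n + 2) → Set X := fun i => {x | L ≤ hh x % K ∧ x ∈ C2 (sig x) i}
  have hlip : ∀ x y, ρ x y ≤ d → hh x ≤ hh y + d ∧ hh y ≤ hh x + d := by
    intro x y hxy
    have a := H.lip x y
    have b := H.lip y x
    rw [hρ.symm] at b
    exact ⟨a.trans (by simp only [hh]; omega), b.trans (by simp only [hh]; omega)⟩
  have hlevle : ∀ m q : ℕ, q ≤ m → K * (q - 1) ≤ K * m := fun m q hq =>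
    Nat.mul_le_mul_left K (by omega)
  have hA : ∀ i, CompBdd ρ d (R1 + 2 * d) (A i) := by
    intro i
    refine CompBdd.pieces (fun x => (hh x / K, lev x)) ?_ ?_
    · rintro x ⟨hx1, hx2, hx3⟩ y ⟨hy1, hy2, hy3⟩ hxy
      obtain ⟨l1, l2⟩ := hlip x y hxy
      have hq := arith_even hK hdL hx1 hy1 l1 l2
      refine Prod.ext hq ?_
      change anc par h (K * (hh x / K - 1)) (f x) = anc par h (K * (hh y / K - 1)) (f y)
      rw [← hq]
      have a := Nat.div_add_mod (hh x) K
      have b := Nat.div_add_mod (hh y) K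
      rw [← hq] at b
      have hle := hlevle (hh x / K) (hh x / K) le_rfl
      refine H.anc_step (by change _ ≤ hh x; omega) (by change _ ≤ hh y; omega) hxy ?_
      rcases Nat.eq_zero_or_pos (hh x / K) with h0 | h0
      · left; rw [h0]; simp
      · right
        change _ ≤ hh x
        have : K * (hh x / K - 1) + K = K * (hh x / K) := by
          rw [← Nat.mul_succ]; congr 1; omega
        omega
    · rintro ⟨m, τ⟩
      refine (hC1 τ i).mono le_rfl le_rfl ?_
      rintro x ⟨⟨hx1, hx2, hx3⟩, hx4⟩
      have : lev x = τ := (Prod.mk.inj hx4).2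
      rwa [this] at hx3
  refine ⟨(R2 + 2 * ((R1 + 2 * d) + 2 * d)) + 2 * (R1 + 2 * d) + 2 * d,
    fun i => A i ∪ B i, fun i => ?_, fun x _ => ?_⟩
  · set c := ((i : ℕ) + 1) * (d + 1) with hc
    have hi : (i : ℕ) < n + 2 := i.2
    have hcL : c + d + 1 ≤ L := by
      have : ((i : ℕ) + 2) * (d + 1) ≤ L := by
        rw [hL]; exact Nat.mul_le_mul_right _ (by omega)
      have e : ((i : ℕ) + 2) * (d + 1) = c + d + 1 := by rw [hc]; ring
      omega
    have hcd : d + 1 ≤ c := by rw [hc]; nlinarith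
    have hncut : ∀ x ∈ A i ∪ B i, (hh x % K) / (d + 1) ≠ i + 1 := by
      rintro x (⟨_, hx, _⟩ | ⟨hx, _⟩)
      · exact hx
      · intro he
        have h1 : hh x % K < (d + 1) * (hh x % K / (d + 1) + 1) :=
          Nat.lt_mul_div_succ _ (by omega)
        rw [he] at h1
        have e : (d + 1) * ((i : ℕ) + 1 + 1) = c + d + 1 := by rw [hc]; ring
        omega
    let M : X → ℕ := fun x => (hh x + K - c) / K
    have hM : ∀ x, K * (M x - 1) ≤ hh x ∧
        (K * (M x - 1) = 0 ∨ K * (M x - 1) + d ≤ hh x) := by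
      intro x
      have h1 : K * M x ≤ hh x + K - c := Nat.mul_div_le _ _
      rcases Nat.eq_zero_or_pos (M x) with h0 | h0
      · rw [h0]; simp
      · have : K * (M x - 1) + K = K * M x := by
          rw [← Nat.mul_succ]; congr 1; omega
        omega
    refine CompBdd.pieces (fun x => (M x, anc par h (K * (M x - 1)) (f x))) ?_ ?_
    · intro x hx y hy hxy
      obtain ⟨l1, l2⟩ := hlip x y hxy
      have n1 := arith_cut (K := K) hc (by omega) (hncut y hy) l2
      have n2 := arith_cut (K := K) hc (by omega) (hncut x hx) l1
      have hMe : M x = M y := by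
        change (hh x + K - c) / K = (hh y + K - c) / K
        omega
      refine Prod.ext hMe ?_
      change anc par h (K * (M x - 1)) (f x) = anc par h (K * (M y - 1)) (f y)
      rw [← hMe]
      refine H.anc_step (hM x).1 ?_ hxy (hM x).2
      rw [hMe]
      exact (hM y).1
    · rintro ⟨m, τ⟩
      refine (CompBdd.union hρ (hA i) (hC2 τ i)).mono le_rfl le_rfl ?_
      rintro x ⟨hx | ⟨hx1, hx2⟩, hx3⟩
      · exact Or.inl hx
      · right
        have e1 : anc par h (K * (M x - 1)) (f x) = τ := (Prod.mk.inj hx3).2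
        have e2 : M x - 1 = hh x / K := by
          have a := Nat.div_add_mod (hh x) K
          have b := Nat.mod_lt (hh x) hKpos
          have : M x = hh x / K + 1 := by
            apply Nat.div_eq_of_lt_le
            · rw [Nat.succ_mul, Nat.mul_comm]; omega
            · rw [Nat.succ_mul, Nat.succ_mul, Nat.mul_comm]; omega
          rw [this, Nat.add_sub_cancel]
        rw [e2] at e1
        have : sig x = τ := e1
        rwa [this] at hx2
  · have a := Nat.div_add_mod (hh x) K
    have b := Nat.mod_lt (hh x) hKpos
    by_cases hx : hh x % K < L
    · have hle := hlevle (hh x / K) (hh x / K) le_rfl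
      have hle2 : K * (hh x / K - 1) ≤ h (f x) := by change _ ≤ hh x; omega
      have hl : h (lev x) = K * (hh x / K - 1) := H.h_anc hle2
      have hge : K * (hh x / K) ≤ K * (hh x / K - 1) + K := by
        rw [← Nat.mul_succ]; exact Nat.mul_le_mul_left K (by omega)
      obtain ⟨i, j, hij, hxi, hxj⟩ := hc1 (lev x) x
        ⟨by rw [hl]; exact hle2, by rw [hl]; change hh x ≤ _; omega, by rw [hl]⟩
      by_cases hz : (hh x % K) / (d + 1) = i + 1
      · refine ⟨j, Or.inl ⟨hx, ?_, hxj⟩⟩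
        intro hz'
        apply hij
        apply Fin.ext
        omega
      · exact ⟨i, Or.inl ⟨hx, hz, hxi⟩⟩
    · have hle2 : K * (hh x / K) ≤ h (f x) := by change _ ≤ hh x; omega
      have hl : h (sig x) = K * (hh x / K) := H.h_anc hle2
      obtain ⟨i, j, hij, hxi, hxj⟩ := hc2 (sig x) x
        ⟨by rw [hl]; exact hle2, by rw [hl]; change hh x ≤ _; omega, by rw [hl]⟩
      exact ⟨i, Or.inr ⟨by omega, hxi⟩⟩

end TreePart
section GraphPart

theorem exists_parent {T : Type*} {G : SimpleGraph T} (hT : G.IsTree) (r : T) :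
    ∃ par : T → T, (∀ a, G.dist r a ≠ 0 → G.dist r (par a) + 1 = G.dist r a) ∧
      (∀ a, G.dist r a = 0 → par a = a) ∧
      ∀ a b, G.Adj a b → a = par b ∨ b = par a := by
  classical
  have hex : ∀ a, ∃ p : T, (G.dist r a ≠ 0 → G.Adj p a ∧ G.dist r p + 1 = G.dist r a) ∧
      (G.dist r a = 0 → p = a) := by
    intro a
    by_cases h0 : G.dist r a = 0
    · exact ⟨a, fun h => absurd h0 h, fun _ => rfl⟩
    · obtain ⟨p, hp⟩ := hT.connected.exists_walk_length_eq_dist a r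
      rw [G.dist_comm] at hp
      cases p with
      | nil => exact absurd G.dist_self h0
      | cons hadj q =>
        rename_i b
        refine ⟨b, fun _ => ⟨hadj.symm, ?_⟩, fun h => absurd h h0⟩
        have h1 := G.dist_le q
        rw [G.dist_comm] at h1
        rw [SimpleGraph.Walk.length_cons] at hp
        rcases hT.dist_eq_dist_add_one_of_adj r hadj with h2 | h2 <;> omega
  choose par h1 h2 using hex
  refine ⟨par, fun a ha => (h1 a ha).2, h2, ?_⟩
  have huniq : ∀ a b, G.Adj a b → G.dist r b = G.dist r a + 1 → a = par b := by
    intro a b hab hd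
    obtain ⟨ha', hd'⟩ := h1 b (by omega)
    obtain ⟨p, hp, hpl⟩ := hT.connected.exists_path_of_dist r a
    obtain ⟨p', hp', hpl'⟩ := hT.connected.exists_path_of_dist r (par b)
    have hq : (p.concat hab).IsPath :=
      SimpleGraph.Walk.isPath_of_length_eq_dist _ (by rw [SimpleGraph.Walk.length_concat]; omega)
    have hq' : (p'.concat ha').IsPath :=
      SimpleGraph.Walk.isPath_of_length_eq_dist _ (by rw [SimpleGraph.Walk.length_concat]; omega)
    have := (hT.existsUnique_path r b).unique hq hq'
    have e := congrArg SimpleGraph.Walk.penultimate this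
    simpa using e
  intro a b hab
  rcases hT.dist_eq_dist_add_one_of_adj r hab with h | h
  · right; exact huniq b a hab.symm h
  · left; exact huniq a b hab h

theorem isDist_dist {X : Type*} {G : SimpleGraph X} (hG : G.Connected) : IsDist G.dist :=
  ⟨fun _ => G.dist_self, fun _ _ => G.dist_comm, fun _ _ _ => hG.dist_triangle⟩

theorem walk_ivp {X : Type*} {G : SimpleGraph X} (Q : X → Prop) {x y : X} (p : G.Walk x y)
    (hx : Q x) (hy : ¬ Q y) : ∃ z z', Q z ∧ ¬ Q z' ∧ G.Adj z z' ∧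
      ∃ q : G.Walk x z', q.length ≤ p.length := by
  induction p with
  | nil => exact absurd hx hy
  | cons hadj p ih =>
    rename_i u v w
    by_cases hv : Q v
    · obtain ⟨z, z', h1, h2, h3, q, hq⟩ := ih hv hy
      exact ⟨z, z', h1, h2, h3, SimpleGraph.Walk.cons hadj q, by simpa using hq⟩
    · exact ⟨u, v, hx, hv, hadj, SimpleGraph.Walk.cons hadj SimpleGraph.Walk.nil, by simp⟩

theorem TreeFib.of_graph {X T : Type*} {GX : SimpleGraph X} {GT : SimpleGraph T}
    (hX : GX.Connected) (hT : GT.IsTree) {f : X → T}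
    (hf : ∀ x y, GX.Adj x y → f x = f y ∨ GT.Adj (f x) (f y)) (r : T) :
    ∃ par, TreeFib GX.dist f par (GT.dist r) := by
  obtain ⟨par, h1, h2, h3⟩ := exists_parent hT r
  refine ⟨par, h1, h2, ?_, ?_⟩
  · intro x y
    obtain ⟨p, hp⟩ := hX.exists_walk_length_eq_dist x y
    rw [← hp]
    clear hp
    induction p with
    | nil => simp
    | cons hadj p ih =>
      rw [SimpleGraph.Walk.length_cons]
      rcases hf _ _ hadj with h | h
      · rw [h]; omega
      · rcases hT.dist_eq_dist_add_one_of_adj r h with h4 | h4 <;> omega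
  · intro Q x y hx hy
    obtain ⟨p, hp⟩ := hX.exists_walk_length_eq_dist x y
    obtain ⟨z, z', a1, a2, a3, q, hq⟩ := walk_ivp Q p hx hy
    refine ⟨z, z', a1, a2, ?_, ?_⟩
    · rw [← hp]; exact (GX.dist_le q).trans hq
    · rcases hf _ _ a3 with h | h
      · exact Or.inl h
      · exact Or.inr (h3 _ _ h)

/-- Acyclicity from a family of integer valued functions. -/
theorem isAcyclic_of_cocycle {T : Type*} {G : SimpleGraph T}
    (h : ∀ a b, G.Adj a b → ∃ χ : T → ℤ, χ a ≠ χ b ∧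
      ∀ a' b', G.Adj a' b' → s(a', b') ≠ s(a, b) → χ a' = χ b') : G.IsAcyclic := by
  rw [SimpleGraph.isAcyclic_iff_forall_adj_isBridge]
  intro a b hab
  obtain ⟨χ, h1, h2⟩ := h a b hab
  rw [SimpleGraph.isBridge_iff]
  intro hr
  obtain ⟨p⟩ := hr
  apply h1
  have : ∀ {x y : T} (q : (G.deleteEdges {s(a, b)}).Walk x y), χ x = χ y := by
    intro x y q
    induction q with
    | nil => rfl
    | cons hadj q ih =>
      rw [← ih]
      rw [SimpleGraph.deleteEdges_adj] at hadj
      exact h2 _ _ hadj.1 (by simpa using hadj.2)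
  exact this p

end GraphPart
section GroupPart

/-- The free action comparison. -/
theorem free_equiv {H : Type*} [Group H] (act : H →* Equiv.Perm ℕ)
    (hfree : ∀ a k, act a k = k → a = 1) (p : ℕ → ℕ) (hp : Function.Surjective p)
    (hinv : ∀ a k, p (act a k) = p k) :
    ∃ θ : H × ℕ ≃ ℕ, ∀ a b k, θ (a * b, k) = act a (θ (b, k)) := by
  let s : Setoid ℕ :=
    { r := fun k l => ∃ a, act a k = l
      iseqv :=
        { refl := fun k => ⟨1, by simp⟩
          symm := by
            rintro k l ⟨a, rfl⟩
            exact ⟨a⁻¹, by simp⟩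
          trans := by
            rintro k l m ⟨a, rfl⟩ ⟨b, rfl⟩
            exact ⟨b * a, by simp⟩ } }
  have hinf : Infinite (Quotient s) := by
    refine Infinite.of_surjective (Quotient.lift p ?_) (β := ℕ) ?_
    · rintro k l ⟨a, rfl⟩
      exact (hinv a k).symm
    · intro m
      obtain ⟨k, rfl⟩ := hp m
      exact ⟨Quotient.mk s k, rfl⟩
  obtain ⟨ε⟩ := nonempty_equiv_of_countable (α := ℕ) (β := Quotient s)
  refine ⟨Equiv.ofBijective (fun x => act x.1 (Quotient.out (ε x.2))) ⟨?_, ?_⟩, ?_⟩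
  · rintro ⟨a, k⟩ ⟨b, l⟩ hab
    simp only at hab
    have h1 : ε k = ε l := by
      rw [← Quotient.out_eq (ε k), ← Quotient.out_eq (ε l)]
      apply Quotient.sound
      have h0 : act (b⁻¹ * a) (Quotient.out (ε k)) = Quotient.out (ε l) := by
        rw [map_mul, Equiv.Perm.mul_apply, hab, ← Equiv.Perm.mul_apply, ← map_mul,
          inv_mul_cancel, map_one, Equiv.Perm.one_apply]
      exact ⟨b⁻¹ * a, h0⟩
    have h2 : k = l := ε.injective h1
    subst h2
    have h3 := hfree (b⁻¹ * a) (Quotient.out (ε k)) (by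
      rw [map_mul, Equiv.Perm.mul_apply, hab, ← Equiv.Perm.mul_apply, ← map_mul]
      simp)
    rw [inv_mul_eq_one] at h3
    rw [h3]
  · intro m
    have : (Quotient.mk s m).out ≈ m := Quotient.mk_out m
    obtain ⟨a, ha⟩ := this
    exact ⟨(a, ε.symm (Quotient.mk s m)), by simpa using ha⟩
  · intro a b k
    change act (a * b) _ = act a (act b _)
    rw [map_mul]
    rfl

variable {V E : Type} (bar : E → E) (t : E → V)
variable (Gv : V → Type) [∀ v, Group (Gv v)]
variable (Ge : E → Type) [∀ e, Group (Ge e)]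
variable (φ : ∀ e, Ge e →* Gv (t e)) (inv : ∀ e, Ge e →* Ge (bar e))

theorem GGF.exists_hom {H : Type*} [Group H] (α : ∀ v, Gv v → H) (β : E → H)
    (h1 : ∀ v a b, α v a * α v b = α v (a * b)) (h2 : ∀ e, β (bar e) * β e = 1)
    (h3 : ∀ e a, β e * α (t e) (φ e a) = α (t (bar e)) (φ (bar e) (inv e a)) * β e) :
    ∃ F : GGF bar t Gv Ge φ inv →* H, (∀ v a, F (ofV bar t Gv Ge φ inv v a) = α v a) ∧
      ∀ e, F (ofE bar t Gv Ge φ inv e) = β e := by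
  let g : ((Σ v : V, Gv v) ⊕ E) → H := Sum.elim (fun x => α x.1 x.2) β
  have hrel : ∀ r ∈ ggRels bar t Gv Ge φ inv, FreeGroup.lift g r = 1 := by
    rintro r ((⟨v, a, b, rfl⟩ | ⟨e, rfl⟩) | ⟨e, a, rfl⟩)
    · simp [g, h1]
    · simp [g, h2]
    · simp [g, h3]
  exact ⟨(PresentedGroup.toGroup hrel : PresentedGroup _ →* H),
    fun v a => PresentedGroup.toGroup.of hrel, fun e => PresentedGroup.toGroup.of hrel⟩

theorem ofV_mul (v : V) (a b : Gv v) : ofV bar t Gv Ge φ inv v (a * b) =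
    ofV bar t Gv Ge φ inv v a * ofV bar t Gv Ge φ inv v b := by
  have h : (PresentedGroup.mk (ggRels bar t Gv Ge φ inv)) (FreeGroup.of (Sum.inl ⟨v, a⟩) *
      FreeGroup.of (Sum.inl ⟨v, b⟩) * (FreeGroup.of (Sum.inl ⟨v, a * b⟩))⁻¹) = 1 :=
    PresentedGroup.one_of_mem (Or.inl (Or.inl ⟨v, a, b, rfl⟩))
  rw [map_mul, map_mul, map_inv, mul_inv_eq_one] at h
  exact h.symm

/-- `ofV` as a homomorphism. -/
noncomputable def ofVHom (v : V) : Gv v →* GGF bar t Gv Ge φ inv :=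
  MonoidHom.mk' (ofV bar t Gv Ge φ inv v) (ofV_mul bar t Gv Ge φ inv v)

theorem ofVHom_apply (v : V) (a : Gv v) :
    ofVHom bar t Gv Ge φ inv v a = ofV bar t Gv Ge φ inv v a := rfl

theorem ofE_bar (e : E) : ofE bar t Gv Ge φ inv (bar e) * ofE bar t Gv Ge φ inv e = 1 := by
  have h : (PresentedGroup.mk (ggRels bar t Gv Ge φ inv)) (FreeGroup.of (Sum.inr (bar e)) *
      FreeGroup.of (Sum.inr e)) = 1 :=
    PresentedGroup.one_of_mem (Or.inl (Or.inr ⟨e, rfl⟩))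
  rw [map_mul] at h
  exact h

theorem ofE_conj (e : E) (a : Ge e) :
    ofE bar t Gv Ge φ inv e * ofV bar t Gv Ge φ inv (t e) (φ e a) =
    ofV bar t Gv Ge φ inv (t (bar e)) (φ (bar e) (inv e a)) * ofE bar t Gv Ge φ inv e := by
  have h : (PresentedGroup.mk (ggRels bar t Gv Ge φ inv)) (FreeGroup.of (Sum.inr e) *
        FreeGroup.of (Sum.inl ⟨t e, φ e a⟩) *
        (FreeGroup.of (Sum.inr e))⁻¹ *
        (FreeGroup.of (Sum.inl ⟨t (bar e), φ (bar e) (inv e a)⟩))⁻¹) = 1 :=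
    PresentedGroup.one_of_mem (Or.inr ⟨e, a, rfl⟩)
  rw [map_mul, map_mul, map_mul, map_inv, map_inv, mul_inv_eq_one, mul_inv_eq_iff_eq_mul] at h
  exact h

theorem GGF.closure_top : Subgroup.closure
    ({x | ∃ v a, x = ofV bar t Gv Ge φ inv v a} ∪ {x | ∃ e, x = ofE bar t Gv Ge φ inv e}) =
      (⊤ : Subgroup (GGF bar t Gv Ge φ inv)) := by
  have h : Subgroup.closure (Set.range (PresentedGroup.of (rels := ggRels bar t Gv Ge φ inv))) =
    ⊤ := PresentedGroup.closure_range_of _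
  rw [eq_top_iff]
  refine le_trans (le_of_eq h.symm) ?_
  apply Subgroup.closure_mono
  rintro x ⟨⟨v, a⟩ | e, rfl⟩
  · exact Or.inl ⟨v, a, rfl⟩
  · exact Or.inr ⟨e, rfl⟩

theorem ofV_injective [∀ v, Countable (Gv v)]
    (hbar : ∀ e, bar (bar e) = e)
    (hφ : ∀ e, Function.Injective (φ e))
    (hinv : ∀ (e : E) (a : Ge e),
      inv (bar e) (inv e a) = cast (congrArg Ge (hbar e)).symm a) (v : V) :
    Function.Injective (ofV bar t Gv Ge φ inv v) := by
  have hβ : ∀ v, Nonempty (Gv v × ℕ ≃ ℕ) := fun v => nonempty_equiv_of_countable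
  let β : ∀ v, Gv v × ℕ ≃ ℕ := fun v => (hβ v).some
  let act : ∀ v, Gv v →* Equiv.Perm ℕ := fun v => MonoidHom.mk'
    (fun a => (β v).symm.trans (((Equiv.mulLeft a).prodCongr (Equiv.refl ℕ)).trans (β v)))
    (by intro a b; ext k; simp [Prod.map])
  have hact : ∀ v a k, act v a k = β v (a * ((β v).symm k).1, ((β v).symm k).2) :=
    fun v a k => rfl
  have hfree : ∀ v a k, act v a k = k → a = 1 := by
    intro v a k h
    rw [hact, ← Equiv.eq_symm_apply] at h
    have := congrArg Prod.fst h
    simpa using this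
  have hθ : ∀ e, ∃ θ : Ge e × ℕ ≃ ℕ, ∀ a b k, θ (a * b, k) = act (t e) (φ e a) (θ (b, k)) := by
    intro e
    refine free_equiv ((act (t e)).comp (φ e)) ?_ (fun k => ((β (t e)).symm k).2) ?_ ?_
    · intro a k h
      exact hφ e (by rw [hfree _ _ _ h, map_one])
    · intro k
      exact ⟨β (t e) (1, k), by simp⟩
    · intro a k
      simp [hact]
  choose θ hθ using hθ
  have hcast : ∀ (e e' : E) (h : e = e') (a : Ge e) (k : ℕ),
      θ e' (cast (congrArg Ge h) a, k) = θ e (a, k) := by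
    intro e e' h a k; subst h; rfl
  let σ : E → ℕ → ℕ := fun e k => θ (bar e) (inv e ((θ e).symm k).1, ((θ e).symm k).2)
  have hσ : ∀ e k, σ (bar e) (σ e k) = k := by
    intro e k
    simp only [σ, Equiv.symm_apply_apply]
    rw [hinv, hcast e _ (hbar e).symm]
    simp
  have hσ' : ∀ e k, σ e (σ (bar e) k) = k := by
    intro e k
    have := hσ (bar e) k
    rwa [hbar] at this
  let s : E → Equiv.Perm ℕ := fun e => ⟨σ e, σ (bar e), hσ e, hσ' e⟩
  obtain ⟨F, hF, -⟩ := GGF.exists_hom bar t Gv Ge φ inv (fun v a => act v a) s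
    (fun v a b => (map_mul _ _ _).symm) (by intro e; ext k; exact hσ e k) (by
      intro e a
      ext k
      change σ e (act (t e) (φ e a) k) = act (t (bar e)) (φ (bar e) (inv e a)) (σ e k)
      obtain ⟨⟨b, l⟩, rfl⟩ := (θ e).surjective k
      rw [← hθ]
      simp only [σ, Equiv.symm_apply_apply]
      rw [map_mul, hθ])
  intro a b hab
  have h := congrArg F hab
  rw [hF, hF] at h
  have h2 : act v (b⁻¹ * a) = 1 := by rw [map_mul, map_inv, h]; simp
  have := hfree v (b⁻¹ * a) 0 (by rw [h2]; rfl)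
  rw [inv_mul_eq_one] at this
  exact this.symm

end GroupPart

section CrossedHom

variable {V E : Type} (bar : E → E) (t : E → V)
variable (Gv : V → Type) [∀ v, Group (Gv v)]
variable (Ge : E → Type) [∀ e, Group (Ge e)]
variable (φ : ∀ e, Ge e →* Gv (t e)) (inv : ∀ e, Ge e →* Ge (bar e))

/-- Crossed homomorphisms on `F(G,Y)`. -/
theorem GGF.exists_crossed (hbar : ∀ e, bar (bar e) = e) {M : Type*} [CommGroup M]
    (act : GGF bar t Gv Ge φ inv →* MulAut M) (δ : V → M) (ε : E → M)
    (h1 : ∀ e, act (ofE bar t Gv Ge φ inv e) (ε (bar e)) = (ε e)⁻¹)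
    (h2 : ∀ e a, act (ofV bar t Gv Ge φ inv (t (bar e)) (φ (bar e) (inv e a))) (ε e) = ε e) :
    ∃ D : GGF bar t Gv Ge φ inv → M, (∀ g h, D (g * h) = D g * act g (D h)) ∧
      (∀ v a, D (ofV bar t Gv Ge φ inv v a) * act (ofV bar t Gv Ge φ inv v a) (δ v) = δ v) ∧
      ∀ e, D (ofE bar t Gv Ge φ inv e) * act (ofE bar t Gv Ge φ inv e) (δ (t e)) =
        δ (t (bar e)) * ε e := by
  obtain ⟨F, hF1, hF2⟩ := GGF.exists_hom bar t Gv Ge φ inv (H := SemidirectProduct M _ act)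
    (fun v a => ⟨δ v * (act (ofV bar t Gv Ge φ inv v a) (δ v))⁻¹, ofV bar t Gv Ge φ inv v a⟩)
    (fun e => ⟨δ (t (bar e)) * ε e * (act (ofE bar t Gv Ge φ inv e) (δ (t e)))⁻¹,
      ofE bar t Gv Ge φ inv e⟩) (by
      intro v a b
      ext
      · simp only [SemidirectProduct.mul_left, map_mul, map_inv, ofV_mul, MulAut.mul_apply]
        group
      · simp only [SemidirectProduct.mul_right, ofV_mul]) (by
      intro e
      have hb := ofE_bar bar t Gv Ge φ inv e
      have h4 := h1 (bar e)
      rw [hbar] at h4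
      ext
      · simp only [SemidirectProduct.mul_left, map_mul, map_inv, h4, ← MulAut.mul_apply]
        rw [← map_mul act, hb]
        simp only [hbar, map_one, MulAut.one_apply, SemidirectProduct.one_left]
        rw [mul_assoc, mul_assoc, mul_assoc, inv_mul_cancel_left, mul_inv_cancel_left,
          mul_inv_cancel]
      · simp only [SemidirectProduct.mul_right, SemidirectProduct.one_right, hb]) (by
      intro e a
      have hc := ofE_conj bar t Gv Ge φ inv e a
      ext
      · simp only [SemidirectProduct.mul_left, map_mul, map_inv, h2, ← MulAut.mul_apply]
        rw [← map_mul act, ← map_mul act, hc]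
        simp [mul_assoc]
      · simp only [SemidirectProduct.mul_right, hc])
  have hr : ∀ g, (F g).right = g := by
    have : (SemidirectProduct.rightHom.comp F) = MonoidHom.id _ := by
      refine MonoidHom.eq_of_eqOn_dense (GGF.closure_top bar t Gv Ge φ inv) ?_
      rintro x (⟨v, a, rfl⟩ | ⟨e, rfl⟩)
      · simp [hF1]
      · simp [hF2]
    exact fun g => DFunLike.congr_fun this g
  refine ⟨fun g => (F g).left, ?_, ?_, ?_⟩
  · intro g h
    change (F (g * h)).left = (F g).left * act g (F h).left
    rw [map_mul, SemidirectProduct.mul_left, hr]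
  · intro v a
    simp [hF1]
  · intro e
    simp [hF2]

end CrossedHom

section Tree

open Pointwise

variable {V E F : Type} [Group F]

/-- The subgroups whose cosets are the vertices of the tree. -/
def optSub (Q : V → Subgroup F) : Option V → Subgroup F
  | none => ⊥
  | some v => Q v

/-- Oriented edges of the tree. -/
inductive TStep (bar : E → E) (t : E → V) (Q : V → Subgroup F) (y : E → F) :
    (Σ u : Option V, F ⧸ optSub Q u) → (Σ u : Option V, F ⧸ optSub Q u) → Prop
  | vert (v : V) (g : F) : TStep bar t Q y ⟨none, QuotientGroup.mk g⟩ ⟨some v, QuotientGroup.mk g⟩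
  | edge (e : E) (g : F) : TStep bar t Q y ⟨some (t (bar e)), QuotientGroup.mk g⟩
      ⟨some (t e), QuotientGroup.mk (g * y e)⟩

/-- Translation action on labelled functions. -/
def trAct (I F : Type) [Group F] : F →* MulAut (I → Set F → Multiplicative ℤ) where
  toFun g :=
    { toFun := fun f i s => f i (g⁻¹ • s)
      invFun := fun f i s => f i (g • s)
      left_inv := fun f => by funext i s; simp
      right_inv := fun f => by funext i s; simp
      map_mul' := fun f f' => rfl }
  map_one' := by ext f i s; simp
  map_mul' g h := by ext f i s; simp [mul_smul]

open Classical in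
/-- Indicator of a label. -/
noncomputable def lbl {I F : Type} (i : I) (s : Set F) : I → Set F → Multiplicative ℤ :=
  fun j s' => if j = i ∧ s' = s then Multiplicative.ofAdd 1 else 1

theorem trAct_lbl {I : Type} (g : F) (i : I) (s : Set F) :
    trAct I F g (lbl i s) = lbl i (g • s) := by
  funext j s'
  simp only [trAct, lbl, MonoidHom.coe_mk, OneHom.coe_mk, MulEquiv.coe_mk, Equiv.coe_fn_mk]
  congr 1
  rw [eq_iff_iff]
  refine and_congr Iff.rfl ?_
  exact inv_smul_eq_iff

theorem lbl_self {I F : Type} (i : I) (s : Set F) : lbl i s i s = Multiplicative.ofAdd 1 := by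
  simp [lbl]

theorem lbl_ne {I F : Type} {i j : I} {s s' : Set F} (h : ¬ (j = i ∧ s' = s)) :
    lbl i s j s' = 1 := by
  simp [lbl, h]

theorem mk_sigma_eq (Q : V → Subgroup F) {v v' : V} (hv : v = v') {g g' : F}
    (h : g⁻¹ * g' ∈ Q v) : (⟨some v, QuotientGroup.mk g⟩ : Σ u : Option V, F ⧸ optSub Q u) =
      ⟨some v', QuotientGroup.mk g'⟩ := by
  subst hv
  have : (QuotientGroup.mk g : F ⧸ optSub Q (some v)) = QuotientGroup.mk g' := by
    rw [QuotientGroup.eq]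
    exact h
  rw [this]

theorem tree_acyclic (bar : E → E) (t : E → V) (hbar : ∀ e, bar (bar e) = e)
    (hbarne : ∀ e, bar e ≠ e) (Q : V → Subgroup F) (y : E → F) (A : E → Subgroup F)
    (hA : ∀ e, A e ≤ Q (t e)) (hy : ∀ e, y (bar e) * y e = 1)
    (hconj : ∀ e, ∀ x ∈ A (bar e), ∃ z ∈ A e, x * y e = y e * z)
    (hD : ∀ (act : F →* MulAut (E ⊕ V → Set F → Multiplicative ℤ))
      (δ : V → E ⊕ V → Set F → Multiplicative ℤ) (ε : E → E ⊕ V → Set F → Multiplicative ℤ),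
      (∀ e, act (y e) (ε (bar e)) = (ε e)⁻¹) → (∀ e, ∀ x ∈ A (bar e), act x (ε e) = ε e) →
      ∃ D : F → E ⊕ V → Set F → Multiplicative ℤ, (∀ g h, D (g * h) = D g * act g (D h)) ∧
        (∀ v, ∀ x ∈ Q v, D x * act x (δ v) = δ v) ∧
        ∀ e, D (y e) * act (y e) (δ (t e)) = δ (t (bar e)) * ε e) :
    (SimpleGraph.fromRel (TStep bar t Q y)).IsAcyclic := by
  have hy' : ∀ e, y e * y (bar e) = 1 := by
    intro e
    have := hy (bar e)
    rwa [hbar] at this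
  have hyi : ∀ e, (y e)⁻¹ = y (bar e) := fun e => inv_eq_of_mul_eq_one_right (hy' e)
  obtain ⟨D, hD1, hD2, hD3⟩ := hD (trAct (E ⊕ V) F) (fun v => lbl (Sum.inr v) {1})
    (fun e => lbl (Sum.inl e) (A (bar e) : Set F) *
      (lbl (Sum.inl (bar e)) (y e • (A e : Set F)))⁻¹) (by
      intro e
      rw [map_mul, map_inv, trAct_lbl, trAct_lbl, hbar, smul_smul, hy', one_smul, mul_inv,
        inv_inv, mul_comm]) (by
      intro e x hx
      rw [map_mul, map_inv, trAct_lbl, trAct_lbl]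
      obtain ⟨z, hz, hxz⟩ := hconj e x hx
      rw [smul_smul, hxz, mul_smul, smul_coe_set hz, smul_coe_set hx])
  let δ' : Option V → E ⊕ V → Set F → Multiplicative ℤ := fun u =>
    match u with
    | none => 1
    | some v => lbl (Sum.inr v) {1}
  let DT : (Σ u : Option V, F ⧸ optSub Q u) → E ⊕ V → Set F → Multiplicative ℤ := fun x =>
    D (Quotient.out x.2) * trAct (E ⊕ V) F (Quotient.out x.2) (δ' x.1)
  have hD0 : D 1 = 1 := by
    have := hD1 1 1
    rw [map_one] at this
    simpa using this
  have hDT : ∀ u g, DT ⟨u, QuotientGroup.mk g⟩ = D g * trAct (E ⊕ V) F g (δ' u) := by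
    intro u g
    obtain ⟨h, hh⟩ := QuotientGroup.mk_out_eq_mul (optSub Q u) g
    have hfix : D h * trAct (E ⊕ V) F h (δ' u) = δ' u := by
      cases u with
      | none =>
        have : (h : F) = 1 := by
          have := h.2
          simpa [optSub] using this
        rw [this, hD0, map_one, one_mul]
      | some v => exact hD2 v h h.2
    change D (Quotient.out (QuotientGroup.mk g)) * trAct (E ⊕ V) F (Quotient.out (QuotientGroup.mk g)) (δ' u) = _
    rw [hh, hD1, map_mul, MulAut.mul_apply, mul_assoc, ← map_mul, hfix]
  have hstep2 : ∀ v g, DT ⟨some v, QuotientGroup.mk g⟩ =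
      DT ⟨none, QuotientGroup.mk g⟩ * lbl (Sum.inr v) {g} := by
    intro v g
    rw [hDT, hDT]
    simp only [δ', trAct_lbl, map_one, mul_one]
    simp
  have hstep3 : ∀ e g, DT ⟨some (t e), QuotientGroup.mk (g * y e)⟩ =
      DT ⟨some (t (bar e)), QuotientGroup.mk g⟩ * (lbl (Sum.inl e) (g • (A (bar e) : Set F)) *
      (lbl (Sum.inl (bar e)) ((g * y e) • (A e : Set F)))⁻¹) := by
    intro e g
    rw [hDT, hDT, hD1, map_mul, MulAut.mul_apply, mul_assoc, ← map_mul]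
    simp only [δ']
    rw [hD3, map_mul, map_mul, map_inv, trAct_lbl, trAct_lbl, trAct_lbl, smul_smul, mul_assoc]
  have key : ∀ a b, TStep bar t Q y a b → ∃ χ : (Σ u : Option V, F ⧸ optSub Q u) → ℤ,
      χ a ≠ χ b ∧ ∀ a' b', TStep bar t Q y a' b' → s(a', b') ≠ s(a, b) → χ a' = χ b' := by
    rintro _ _ (⟨v, g⟩ | ⟨e, g⟩)
    · refine ⟨fun x => Multiplicative.toAdd (DT x (Sum.inr v) {g}), ?_, ?_⟩
      · simp only [hstep2, Pi.mul_apply, lbl_self]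
        simp
      · rintro _ _ (⟨v', g'⟩ | ⟨e', g'⟩) hne
        · simp only [hstep2, Pi.mul_apply]
          rw [lbl_ne, mul_one]
          rintro ⟨h1, h2⟩
          rw [Sum.inr.injEq] at h1
          rw [Set.singleton_eq_singleton_iff] at h2
          subst h1 h2
          exact hne rfl
        · simp only [hstep3, Pi.mul_apply, Pi.inv_apply]
          rw [lbl_ne (by simp), lbl_ne (by simp)]
          simp
    · refine ⟨fun x => Multiplicative.toAdd (DT x (Sum.inl e) (g • (A (bar e) : Set F))), ?_, ?_⟩
      · simp only [hstep3, Pi.mul_apply, Pi.inv_apply, lbl_self]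
        rw [lbl_ne (by simp [(hbarne e).symm])]
        simp
      · rintro _ _ (⟨v', g'⟩ | ⟨e', g'⟩) hne
        · simp only [hstep2, Pi.mul_apply]
          rw [lbl_ne (by simp)]
          simp
        · simp only [hstep3, Pi.mul_apply, Pi.inv_apply]
          rw [lbl_ne, lbl_ne]
          · simp
          · rintro ⟨h1, h2⟩
            rw [Sum.inl.injEq] at h1
            subst h1
            rw [hbar] at h2
            apply hne
            have h3 : g ∈ (g' * y e') • (A e' : Set F) := by
              rw [← h2]
              exact ⟨1, (A e').one_mem, by simp⟩
            obtain ⟨x, hx, hx'⟩ := h3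
            simp only [smul_eq_mul] at hx'
            obtain ⟨z, hz, hxz⟩ := hconj (bar e') x (by rwa [hbar])
            subst hx'
            rw [Sym2.eq_swap]
            have h5 : g'⁻¹ * (g' * y e' * x * y (bar e')) = z := by
              rw [mul_assoc _ x, hxz, ← mul_assoc, inv_mul_cancel_left, ← mul_assoc, hy',
                one_mul]
            rw [mk_sigma_eq Q (congrArg t (hbar e').symm) (g := g' * y e') (g' := g' * y e' * x)
              (by rw [inv_mul_cancel_left]; exact hA e' hx), mk_sigma_eq Q (rfl : t (bar e') = t (bar e')) (g := g')
              (g' := g' * y e' * x * y (bar e')) (by rw [h5]; exact hA _ hz)]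
          · rintro ⟨h1, h2⟩
            rw [Sum.inl.injEq] at h1
            subst h1
            apply hne
            have h3 : g' ∈ g • (A (bar e) : Set F) := by
              rw [h2]
              exact ⟨1, (A (bar e)).one_mem, by simp⟩
            obtain ⟨x, hx, hx'⟩ := h3
            simp only [smul_eq_mul] at hx'
            obtain ⟨z, hz, hxz⟩ := hconj e x hx
            subst hx'
            have h5 : (g * y e)⁻¹ * (g * x * y e) = z := by
              rw [mul_assoc _ x, hxz]
              group
            rw [mk_sigma_eq Q (rfl : t (bar e) = t (bar e)) (g := g) (g' := g * x)
              (by simpa using hA _ hx), mk_sigma_eq Q (rfl : t e = t e) (g := g * y e)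
              (g' := g * x * y e) (by rw [h5]; exact hA _ hz)]
  apply isAcyclic_of_cocycle
  have key2 : ∀ a b, (SimpleGraph.fromRel (TStep bar t Q y)).Adj a b →
      TStep bar t Q y a b ∨ TStep bar t Q y b a := fun a b h => h.2
  intro a b hab
  rcases key2 a b hab with h | h
  · obtain ⟨χ, h1, h2⟩ := key a b h
    refine ⟨χ, h1, ?_⟩
    intro a' b' h' hne
    rcases key2 a' b' h' with h' | h'
    · exact h2 a' b' h' hne
    · exact (h2 b' a' h' (by rwa [Sym2.eq_swap])).symm
  · obtain ⟨χ, h1, h2⟩ := key b a h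
    refine ⟨χ, h1.symm, ?_⟩
    intro a' b' h' hne
    rw [Sym2.eq_swap (a := a)] at hne
    rcases key2 a' b' h' with h' | h'
    · exact h2 a' b' h' hne
    · exact (h2 b' a' h' (by rwa [Sym2.eq_swap])).symm

end Tree

section WordMetric

variable {Γ : Type*} [Group Γ] {S : Set Γ}

theorem wordDist_le_of_list {g h : Γ} {k : ℕ} (l : List Γ) (hl : l.length ≤ k)
    (hS : ∀ s ∈ l, s ∈ S) (hp : l.prod = g⁻¹ * h) : wordDist S g h ≤ k :=
  le_trans (Nat.sInf_le ⟨l, rfl, hS, hp⟩) hl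

theorem exists_list_wordDist (hgen : Subgroup.closure S = ⊤) (hsym : ∀ s ∈ S, s⁻¹ ∈ S) (g h : Γ) :
    ∃ l : List Γ, l.length = wordDist S g h ∧ (∀ s ∈ l, s ∈ S) ∧ l.prod = g⁻¹ * h := by
  have hne : {n : ℕ | ∃ l : List Γ, l.length = n ∧ (∀ s ∈ l, s ∈ S) ∧
      l.prod = g⁻¹ * h}.Nonempty := by
    have hm : g⁻¹ * h ∈ Subgroup.closure S := by rw [hgen]; trivial
    rw [← Subgroup.mem_toSubmonoid, Subgroup.closure_toSubmonoid] at hm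
    obtain ⟨l, hl, hp⟩ := Submonoid.exists_list_of_mem_closure hm
    refine ⟨l.length, l, rfl, ?_, hp⟩
    intro s hs
    rcases hl s hs with h | h
    · exact h
    · have := hsym _ h
      rwa [inv_inv] at this
  exact Nat.sInf_mem hne

theorem isDist_wordDist (hgen : Subgroup.closure S = ⊤) (hsym : ∀ s ∈ S, s⁻¹ ∈ S) :
    IsDist (wordDist S) := by
  have hle : ∀ g h, wordDist S h g ≤ wordDist S g h := by
    intro g h
    obtain ⟨l, h1, h2, h3⟩ := exists_list_wordDist hgen hsym g h
    refine wordDist_le_of_list (l.map (·⁻¹)).reverse (by simp [h1]) ?_ ?_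
    · intro s hs
      simp only [List.mem_reverse, List.mem_map] at hs
      obtain ⟨s', hs', rfl⟩ := hs
      exact hsym _ (h2 _ hs')
    · rw [← List.prod_inv_reverse, h3]
      group
  refine ⟨?_, ?_, ?_⟩
  · intro g
    exact Nat.le_zero.mp (wordDist_le_of_list [] (by simp) (by simp) (by simp))
  · intro g h
    exact le_antisymm (hle _ _) (hle _ _)
  · intro g h k
    obtain ⟨l, h1, h2, h3⟩ := exists_list_wordDist hgen hsym g h
    obtain ⟨l', h1', h2', h3'⟩ := exists_list_wordDist hgen hsym h k
    refine wordDist_le_of_list (l ++ l') (by simp [h1, h1']) ?_ ?_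
    · intro s hs
      rcases List.mem_append.mp hs with h | h
      · exact h2 s h
      · exact h2' s h
    · rw [List.prod_append, h3, h3']
      group

theorem wordDist_proper {G : Type*} [Group G] (hgen : Subgroup.closure S = ⊤)
    (hsym : ∀ s ∈ S, s⁻¹ ∈ S) (hfin : S.Finite) (i : G →* Γ) (hi : Function.Injective i)
    (S' : Set G) (D : ℕ) : ∃ D', ∀ a b : G, wordDist S (i a) (i b) ≤ D → wordDist S' a b ≤ D' := by
  have hfl : {l : List Γ | (∀ s ∈ l, s ∈ S) ∧ l.length ≤ D}.Finite := by
    have : Finite S := hfin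
    have h := (List.finite_length_le S D).image (List.map Subtype.val)
    refine h.subset ?_
    rintro l ⟨h1, h2⟩
    exact ⟨l.attachWith (· ∈ S) h1, by simpa using h2, by simp⟩
  have hf2 : {a : G | wordDist S 1 (i a) ≤ D}.Finite := by
    refine Set.Finite.subset ((hfl.image List.prod).preimage (f := i) hi.injOn) ?_
    intro a ha
    obtain ⟨l, h1, h2, h3⟩ := exists_list_wordDist hgen hsym 1 (i a)
    exact ⟨l, ⟨h2, h1 ▸ ha⟩, by simpa using h3⟩
  obtain ⟨D', hD'⟩ := (hf2.image (wordDist S' 1)).bddAbove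
  refine ⟨D', fun a b hab => ?_⟩
  have h1 : wordDist S 1 (i (a⁻¹ * b)) = wordDist S (i a) (i b) := by simp [wordDist]
  have h2 : wordDist S' 1 (a⁻¹ * b) = wordDist S' a b := by simp [wordDist]
  rw [← h2]
  exact hD' ⟨a⁻¹ * b, by change wordDist S 1 (i (a⁻¹ * b)) ≤ D; rw [h1]; exact hab, rfl⟩

theorem CoarseChain.symm' {X : Type*} {ρ : X → X → ℕ} (hρ : IsDist ρ) {d : ℕ} {A : Set X} {x y : X}
    (h : CoarseChain ρ d A x y) : CoarseChain ρ d A y x := by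
  induction h with
  | refl => exact Relation.ReflTransGen.refl
  | tail _ hstep ih =>
    obtain ⟨h1, h2, h3⟩ := hstep
    exact Relation.ReflTransGen.head ⟨h2, h1, by rwa [hρ.symm]⟩ ih

theorem ASDimLEdist_of_coarseCov {X : Type*} {ρ : X → X → ℕ} (hρ : IsDist ρ) {n : ℕ}
    (h : ∀ d, ∃ R, CoarseCov ρ n d R univ) (P : Set X) :
    ASDimLEdist (fun a b : P => (ρ a b : ℝ)) n := by
  intro d hd
  obtain ⟨R, C, hC, hcov⟩ := h ⌈d⌉₊
  refine ⟨fun i => {U | ∃ x : P, U = {y : P | (y : X) ∈ C i ∧ CoarseChain ρ ⌈d⌉₊ (C i) x y}},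
    ?_, ?_⟩
  · intro i
    refine ⟨⟨((R + R : ℕ) : ℝ), ?_⟩, ?_⟩
    · rintro U ⟨z, rfl⟩ x ⟨-, hx⟩ y ⟨-, hy⟩
      have h1 := hC i _ _ hx
      have h2 := hC i _ _ hy
      rw [hρ.symm] at h1
      have h3 := hρ.tri x z y
      have : ρ x y ≤ R + R := by omega
      change ((ρ x y : ℕ) : ℝ) ≤ _
      exact_mod_cast this
    · rintro U ⟨z, rfl⟩ U' ⟨z', rfl⟩ hne x ⟨hx, hzx⟩ y ⟨hy, hzy⟩
      by_contra hlt
      rw [not_le] at hlt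
      apply hne
      have hxy : CoarseChain ρ ⌈d⌉₊ (C i) x y := by
        refine Relation.ReflTransGen.single ⟨hx, hy, ?_⟩
        have : ((ρ x y : ℕ) : ℝ) ≤ (⌈d⌉₊ : ℝ) := hlt.le.trans (Nat.le_ceil d)
        exact_mod_cast this
      have hzz : CoarseChain ρ ⌈d⌉₊ (C i) z z' :=
        Relation.ReflTransGen.trans (Relation.ReflTransGen.trans hzx hxy) (hzy.symm' hρ)
      ext w
      refine and_congr Iff.rfl ⟨fun h => ?_, fun h => ?_⟩
      · exact Relation.ReflTransGen.trans (hzz.symm' hρ) h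
      · exact Relation.ReflTransGen.trans hzz h
  · intro z
    obtain ⟨i, hi⟩ := hcov z trivial
    exact ⟨i, _, ⟨z, rfl⟩, hi, Relation.ReflTransGen.refl⟩

end WordMetric

section Geometry

variable {V E F : Type} [Group F] {Gv : V → Type} [∀ v, Group (Gv v)]

/-- Oriented edges of the covering graph. -/
inductive XStep (bar : E → E) (t : E → V) (i : ∀ v, Gv v →* F) (y : E → F)
    (Sv : ∀ v, Finset (Gv v)) : F × Option V → F × Option V → Prop
  | base (v : V) (g : F) : XStep bar t i y Sv (g, none) (g, some v)
  | vert (v : V) (g : F) (s : Gv v) (hs : s ∈ Sv v) :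
      XStep bar t i y Sv (g, some v) (g * i v s, some v)
  | edge (e : E) (g : F) : XStep bar t i y Sv (g, some (t (bar e))) (g * y e, some (t e))

theorem exists_walk_of_rel {X : Type*} {r : X → X → Prop} {x y : X} (h : r x y ∨ r y x) :
    ∃ p : (SimpleGraph.fromRel r).Walk x y, p.length ≤ 1 := by
  by_cases hxy : x = y
  · subst hxy
    exact ⟨SimpleGraph.Walk.nil, by simp⟩
  · have : (SimpleGraph.fromRel r).Adj x y := ⟨hxy, h⟩
    exact ⟨SimpleGraph.Walk.cons this SimpleGraph.Walk.nil, by simp⟩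

variable (bar : E → E) (t : E → V) (i : ∀ v, Gv v →* F) (y : E → F) (Sv : ∀ v, Finset (Gv v))

/-- The generating set. -/
def genS : Set F :=
  {x | ∃ v, ∃ s ∈ Sv v, x = i v s} ∪ {x | ∃ e : E, x = y e ∨ x = (y e)⁻¹}

theorem walk_list (l : List F) (hl : ∀ s ∈ l, s ∈ genS i y Sv) (g : F) :
    ∃ p : (SimpleGraph.fromRel (XStep bar t i y Sv)).Walk (g, none) (g * l.prod, none),
      p.length ≤ 3 * l.length := by
  induction l generalizing g with
  | nil =>
    rw [List.prod_nil, mul_one]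
    exact ⟨SimpleGraph.Walk.nil, by simp⟩
  | cons s l ih =>
    obtain ⟨q, hq⟩ := ih (fun s' hs' => hl s' (List.mem_cons_of_mem _ hs')) (g * s)
    rw [List.prod_cons, ← mul_assoc]
    have key : ∃ v w : V, ∃ p : (SimpleGraph.fromRel (XStep bar t i y Sv)).Walk (g, some v)
        (g * s, some w), p.length ≤ 1 := by
      rcases hl s List.mem_cons_self with ⟨v, s, hs, rfl⟩ | ⟨e, rfl | rfl⟩
      · exact ⟨v, v, exists_walk_of_rel (Or.inl (XStep.vert v g s hs))⟩
      · exact ⟨_, _, exists_walk_of_rel (Or.inl (XStep.edge e g))⟩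
      · refine ⟨t e, t (bar e), exists_walk_of_rel (Or.inr ?_)⟩
        · have := XStep.edge (bar := bar) (t := t) (i := i) (y := y) (Sv := Sv) e (g * (y e)⁻¹)
          rwa [inv_mul_cancel_right] at this
    obtain ⟨v, w, p, hp⟩ := key
    obtain ⟨p1, hp1⟩ := exists_walk_of_rel (r := XStep bar t i y Sv) (Or.inl (XStep.base v g))
    obtain ⟨p2, hp2⟩ := exists_walk_of_rel (r := XStep bar t i y Sv)
      (Or.inr (XStep.base w (g * s)))
    refine ⟨p1.append (p.append (p2.append q)), ?_⟩
    simp only [SimpleGraph.Walk.length_append, List.length_cons]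
    omega

theorem walk_list_vert (v : V) (l : List (Gv v)) (hl : ∀ s ∈ l, s ∈ Sv v) (g : F) :
    ∃ p : (SimpleGraph.fromRel (XStep bar t i y Sv)).Walk (g, some v) (g * i v l.prod, some v),
      p.length ≤ l.length := by
  induction l generalizing g with
  | nil =>
    rw [List.prod_nil, map_one, mul_one]
    exact ⟨SimpleGraph.Walk.nil, by simp⟩
  | cons s l ih =>
    obtain ⟨q, hq⟩ := ih (fun s' hs' => hl s' (List.mem_cons_of_mem _ hs')) (g * i v s)
    rw [List.prod_cons, map_mul, ← mul_assoc]
    obtain ⟨p, hp⟩ := exists_walk_of_rel (r := XStep bar t i y Sv)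
      (Or.inl (XStep.vert v g s (hl s List.mem_cons_self)))
    refine ⟨p.append q, ?_⟩
    simp only [SimpleGraph.Walk.length_append, List.length_cons]
    omega

theorem genS_symm (hsym : ∀ v, ∀ s ∈ Sv v, s⁻¹ ∈ Sv v) : ∀ s ∈ genS i y Sv, s⁻¹ ∈ genS i y Sv := by
  rintro _ (⟨v, s, hs, rfl⟩ | ⟨e, rfl | rfl⟩)
  · exact Or.inl ⟨v, s⁻¹, hsym v s hs, by simp⟩
  · exact Or.inr ⟨e, Or.inr rfl⟩
  · exact Or.inr ⟨e, Or.inl (by simp)⟩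

theorem genS_finite [Finite V] [Finite E] : (genS i y Sv).Finite := by
  refine Set.Finite.union ?_ ?_
  · have : {x | ∃ v, ∃ s ∈ Sv v, x = i v s} = ⋃ v, (i v) '' (Sv v) := by
      ext x
      simp only [Set.mem_ofPred_eq, Set.mem_iUnion, Set.mem_image, Finset.mem_coe]
      exact ⟨fun ⟨v, s, hs, h⟩ => ⟨v, s, hs, h.symm⟩, fun ⟨v, s, hs, h⟩ => ⟨v, s, hs, h.symm⟩⟩
    rw [this]
    exact Set.finite_iUnion fun v => (Sv v).finite_toSet.image _
  · have : {x | ∃ e : E, x = y e ∨ x = (y e)⁻¹} = Set.range y ∪ Set.range (fun e => (y e)⁻¹) := by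
      ext x
      simp only [Set.mem_ofPred_eq, Set.mem_union, Set.mem_range]
      constructor
      · rintro ⟨e, h | h⟩
        · exact Or.inl ⟨e, h.symm⟩
        · exact Or.inr ⟨e, h.symm⟩
      · rintro (⟨e, h⟩ | ⟨e, h⟩)
        · exact ⟨e, Or.inl h.symm⟩
        · exact ⟨e, Or.inr h.symm⟩
    rw [this]
    exact (Set.finite_range _).union (Set.finite_range _)

theorem wordDist_le_walk (hgen : Subgroup.closure (genS i y Sv) = ⊤)
    (hsym : ∀ v, ∀ s ∈ Sv v, s⁻¹ ∈ Sv v) {x x' : F × Option V}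
    (p : (SimpleGraph.fromRel (XStep bar t i y Sv)).Walk x x') :
    wordDist (genS i y Sv) x.1 x'.1 ≤ p.length := by
  have hd := isDist_wordDist hgen (genS_symm i y Sv hsym)
  have hstep : ∀ a b, XStep bar t i y Sv a b → wordDist (genS i y Sv) a.1 b.1 ≤ 1 := by
    rintro _ _ (⟨v, g⟩ | ⟨v, g, s, hs⟩ | ⟨e, g⟩)
    · simp [hd.self]
    · exact wordDist_le_of_list [i v s] (by simp) (by
        intro s' hs'
        rw [List.mem_singleton] at hs'
        subst hs'
        exact Or.inl ⟨v, s, hs, rfl⟩) (by simp)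
    · exact wordDist_le_of_list [y e] (by simp) (by
        intro s' hs'
        rw [List.mem_singleton] at hs'
        subst hs'
        exact Or.inr ⟨e, Or.inl rfl⟩) (by simp)
  induction p with
  | nil => simp [hd.self]
  | cons hadj p ih =>
    rename_i a b c
    have h1 : wordDist (genS i y Sv) a.1 b.1 ≤ 1 := by
      rcases hadj.2 with h | h
      · exact hstep _ _ h
      · rw [hd.symm]; exact hstep _ _ h
    have := hd.tri a.1 b.1 c.1
    rw [SimpleGraph.Walk.length_cons]
    omega

theorem GX_connected (hgen : Subgroup.closure (genS i y Sv) = ⊤)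
    (hsym : ∀ v, ∀ s ∈ Sv v, s⁻¹ ∈ Sv v) :
    (SimpleGraph.fromRel (XStep bar t i y Sv)).Connected := by
  have h0 : ∀ x : F × Option V,
      (SimpleGraph.fromRel (XStep bar t i y Sv)).Reachable (1, none) x := by
    rintro ⟨g, u⟩
    obtain ⟨l, -, h2, h3⟩ := exists_list_wordDist hgen (genS_symm i y Sv hsym) 1 g
    obtain ⟨p, -⟩ := walk_list bar t i y Sv l h2 1
    rw [h3] at p
    simp only [inv_one, one_mul] at p
    cases u with
    | none => exact ⟨p⟩
    | some v =>
      obtain ⟨q, -⟩ := exists_walk_of_rel (r := XStep bar t i y Sv) (Or.inl (XStep.base v g))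
      exact ⟨p.append q⟩
  have : Nonempty (F × Option V) := ⟨(1, none)⟩
  exact SimpleGraph.Connected.mk fun a b => (h0 a).symm.trans (h0 b)

theorem asdim_geometry [Finite V] [Finite E]
    (hgen : Subgroup.closure (genS i y Sv) = ⊤)
    (hgenv : ∀ v, Subgroup.closure ((Sv v : Set (Gv v))) = ⊤)
    (hsym : ∀ v, ∀ s ∈ Sv v, s⁻¹ ∈ Sv v)
    (hi : ∀ v, Function.Injective (i v))
    (hacyc : (SimpleGraph.fromRel (TStep bar t (fun v => (i v).range) y)).IsAcyclic) (n : ℕ)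
    (hasdim : ∀ v : V,
      ASDimLEdist (fun a b : Gv v => (wordDist (Sv v : Set (Gv v)) a b : ℝ)) n) (d : ℕ) :
    ∃ R, CoarseCov (wordDist (genS i y Sv)) (n + 1) d R univ := by
  have hGX := GX_connected bar t i y Sv hgen hsym
  set GX := SimpleGraph.fromRel (XStep bar t i y Sv) with hGXdef
  set GT := SimpleGraph.fromRel (TStep bar t (fun v => (i v).range) y) with hGTdef
  let f : F × Option V → Σ u : Option V, F ⧸ optSub (fun v => (i v).range) u :=
    fun x => ⟨x.2, QuotientGroup.mk x.1⟩
  have hfs : ∀ a b, XStep bar t i y Sv a b → f a = f b ∨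
      TStep bar t (fun v => (i v).range) y (f a) (f b) := by
    rintro _ _ (⟨v, g⟩ | ⟨v, g, s, hs⟩ | ⟨e, g⟩)
    · exact Or.inr (TStep.vert v g)
    · refine Or.inl (mk_sigma_eq _ rfl ?_)
      exact ⟨s, by simp⟩
    · exact Or.inr (TStep.edge e g)
  have hf : ∀ a b, GX.Adj a b → f a = f b ∨ GT.Adj (f a) (f b) := by
    intro a b hab
    by_cases h : f a = f b
    · exact Or.inl h
    · refine Or.inr ⟨h, ?_⟩
      rcases hab.2 with h' | h'
      · exact Or.inl ((hfs _ _ h').resolve_left h)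
      · exact Or.inr ((hfs _ _ h').resolve_left (Ne.symm h))
  have hGT : GT.IsTree := by
    have hr : ∀ a b, GX.Walk a b → GT.Reachable (f a) (f b) := by
      intro a b p
      induction p with
      | nil => exact SimpleGraph.Reachable.refl _
      | cons hadj p ih =>
        rcases hf _ _ hadj with h | h
        · rw [h]; exact ih
        · exact h.reachable.trans ih
    have : Nonempty (Σ u : Option V, F ⧸ optSub (fun v => (i v).range) u) := ⟨f (1, none)⟩
    refine ⟨SimpleGraph.Connected.mk ?_, hacyc⟩
    rintro ⟨u, a⟩ ⟨u', b⟩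
    obtain ⟨g, rfl⟩ := QuotientGroup.mk_surjective a
    obtain ⟨g', rfl⟩ := QuotientGroup.mk_surjective b
    obtain ⟨p⟩ := hGX.preconnected (g, u) (g', u')
    exact hr _ _ p
  obtain ⟨par, H⟩ := TreeFib.of_graph hGX hGT hf (f (1, none))
  have hwd := isDist_wordDist hgen (genS_symm i y Sv hsym)
  have hle : ∀ a b, wordDist (genS i y Sv) a.1 b.1 ≤ GX.dist a b := by
    intro a b
    obtain ⟨p, hp⟩ := hGX.exists_walk_length_eq_dist a b
    rw [← hp]
    exact wordDist_le_walk bar t i y Sv hgen hsym p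
  have hfib1 : ∀ d v, ∃ R, ∀ q, CoarseCov GX.dist n d R (f ⁻¹' {⟨some v, q⟩}) := by
    intro d v
    obtain ⟨D', hD'⟩ := wordDist_proper hgen (genS_symm i y Sv hsym) (genS_finite i y Sv) (i v)
      (hi v) (Sv v : Set (Gv v)) d
    obtain ⟨U, hU, hcov⟩ := hasdim v ((D' + 1 : ℕ) : ℝ) (by positivity)
    choose hR hsep using hU
    choose R hR using hR
    obtain ⟨R', hR'⟩ := Finite.exists_le (fun j => ⌈R j⌉₊)
    refine ⟨R', fun q => ?_⟩
    obtain ⟨g, rfl⟩ := QuotientGroup.mk_surjective q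
    refine ⟨fun j => {x | ∃ W ∈ U j, ∃ a ∈ W, x = (g * i v a, some v)}, ?_, ?_⟩
    · intro j x x' hx
      have hch : x = x' ∨ ∃ W ∈ U j, ∃ a ∈ W, ∃ b ∈ W, x = (g * i v a, some v) ∧
          x' = (g * i v b, some v) := by
        induction hx with
        | refl => exact Or.inl rfl
        | tail _ hstep ih =>
          rename_i b0 c0 _
          obtain ⟨⟨W1, hW1, a1, ha1, e1⟩, ⟨W2, hW2, a2, ha2, e2⟩, hd⟩ := hstep
          have key : ∀ W ∈ U j, ∀ a ∈ W, ∀ z, z = (g * i v a, some v) → GX.dist z c0 ≤ d →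
              W = W2 := by
            intro W hW a ha z hz hzd
            by_contra hne
            have h1 := hsep j W hW W2 hW2 hne a ha a2 ha2
            have h2 := (hle _ _).trans hzd
            rw [hz, e2] at h2
            have h3 : wordDist (genS i y Sv) (i v a) (i v a2) ≤ d := by
              refine le_trans (le_of_eq ?_) h2
              simp [wordDist, mul_assoc]
            have h4 := hD' _ _ h3
            have h5 : D' + 1 ≤ wordDist (Sv v : Set (Gv v)) a a2 := by
              simp only at h1
              exact_mod_cast h1
            omega
          rcases ih with rfl | ⟨W, hW, a, ha, b, hb, ex, ez⟩
          · have := key W1 hW1 a1 ha1 _ e1 hd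
            subst this
            exact Or.inr ⟨W1, hW1, a1, ha1, a2, ha2, e1, e2⟩
          · have := key W hW b hb _ ez hd
            subst this
            exact Or.inr ⟨W, hW, a, ha, a2, ha2, ex, e2⟩
      rcases hch with rfl | ⟨W, hW, a, ha, b, hb, rfl, rfl⟩
      · rw [SimpleGraph.dist_self]; exact Nat.zero_le _
      · have h1 := hR j W hW a ha b hb
        obtain ⟨l, hl1, hl2, hl3⟩ := exists_list_wordDist (hgenv v) (hsym v) a b
        obtain ⟨p, hp⟩ := walk_list_vert bar t i y Sv v l hl2 (g * i v a)
        have h2 := (SimpleGraph.dist_le p).trans hp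
        have h3 : g * i v a * i v l.prod = g * i v b := by
          rw [hl3, map_mul, map_inv]; group
        rw [h3] at h2
        have h4 : wordDist (Sv v : Set (Gv v)) a b ≤ ⌈R j⌉₊ := by
          have := h1.trans (Nat.le_ceil (R j))
          simp only at this
          exact_mod_cast this
        have h5 := hR' j
        rw [hl1] at h2
        exact h2.trans (h4.trans h5)
    · rintro ⟨g', u⟩ hx
      have hx' : f (g', u) = ⟨some v, QuotientGroup.mk g⟩ := hx
      have hu : u = some v := congrArg Sigma.fst hx'
      subst hu
      have hq : (QuotientGroup.mk g' : F ⧸ optSub (fun v => (i v).range) (some v)) =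
        QuotientGroup.mk g := by simpa [f] using hx'
      have hq := QuotientGroup.eq.mp hq.symm
      obtain ⟨a, ha⟩ : g⁻¹ * g' ∈ (i v).range := hq
      obtain ⟨j, W, hW, haW⟩ := hcov a
      exact ⟨j, W, hW, a, haW, by rw [ha, mul_inv_cancel_left]⟩
  have hfib : ∀ d, ∃ R, ∀ a, CoarseCov GX.dist n d R (f ⁻¹' {a}) := by
    intro d
    choose R hR using hfib1 d
    obtain ⟨R', hR'⟩ := Finite.exists_le R
    refine ⟨R', ?_⟩
    rintro ⟨u, q⟩
    cases u with
    | none =>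
      refine ⟨fun _ => f ⁻¹' {⟨none, q⟩}, ?_, fun x hx => ⟨0, hx⟩⟩
      intro _ x x' hx
      have hch : x = x' := by
        induction hx with
        | refl => rfl
        | tail _ hstep ih =>
          rename_i b c _
          rw [ih]
          obtain ⟨h1, h2, -⟩ := hstep
          obtain ⟨g, u⟩ := b
          obtain ⟨g', u'⟩ := c
          have h3 : f (g, u) = f (g', u') := h1.trans h2.symm
          have h1' : f (g, u) = ⟨none, q⟩ := h1
          have h2' : f (g', u') = ⟨none, q⟩ := h2
          have hu : u = none := congrArg Sigma.fst h1'
          have hu' : u' = none := congrArg Sigma.fst h2'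
          subst hu hu'
          have hq : (QuotientGroup.mk g : F ⧸ optSub (fun v => (i v).range) none) =
            QuotientGroup.mk g' := by simpa [f] using h3
          have hq : g⁻¹ * g' ∈ (⊥ : Subgroup F) := QuotientGroup.eq.mp hq
          rw [Subgroup.mem_bot, inv_mul_eq_one] at hq
          rw [hq]
      rw [hch, SimpleGraph.dist_self]
      exact Nat.zero_le _
    | some v =>
      obtain ⟨C, h1, h2⟩ := hR v q
      exact ⟨C, fun j x x' h => (h1 j x x' h).trans (hR' v), h2⟩
  obtain ⟨R, C, hC, hcov⟩ := H.main (isDist_dist hGX) hfib (3 * d)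
  refine ⟨R, fun j => {g | (g, none) ∈ C j}, ?_, fun g _ => hcov (g, none) trivial⟩
  intro j g g' h
  refine (hle (g, none) (g', none)).trans (hC j _ _ ?_)
  induction h with
  | refl => exact Relation.ReflTransGen.refl
  | tail _ hstep ih =>
    rename_i a b _
    obtain ⟨h1, h2, h3⟩ := hstep
    refine Relation.ReflTransGen.tail ih ⟨h1, h2, ?_⟩
    obtain ⟨l, hl1, hl2, hl3⟩ := exists_list_wordDist hgen (genS_symm i y Sv hsym) a b
    obtain ⟨p, hp⟩ := walk_list bar t i y Sv l hl2 a
    have h4 := (SimpleGraph.dist_le p).trans hp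
    rw [hl3, mul_inv_cancel_left, hl1] at h4
    exact h4.trans (Nat.mul_le_mul_left 3 h3)

end Geometry
/-- Theorem 1′: let `(G,Y)` be a finite connected graph of groups with finitely generated
vertex groups satisfying `asdim G_v ≤ n` for all vertices `v`. Then the fundamental group
`π₁(G,Y,v₀) ⊆ F(G,Y)` (the elements represented by words of type `c` with
`i(c) = v₀ = t(c)`), with the word metric of `F(G,Y)` coming from the vertex generators
together with the edge letters, satisfies `asdim π₁(G,Y,v₀) ≤ n + 1`, for any vertex
`v₀`. -/
theorem asdim_fundamental_group_graph_of_groups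
    {V E : Type} [Finite V] [Finite E] (bar : E → E) (t : E → V)
    (Gv : V → Type) [∀ v, Group (Gv v)] (Ge : E → Type) [∀ e, Group (Ge e)]
    (φ : ∀ e, Ge e →* Gv (t e)) (inv : ∀ e, Ge e →* Ge (bar e))
    (hbar : ∀ e, bar (bar e) = e) (hbarne : ∀ e, bar e ≠ e)
    (hφ : ∀ e, Function.Injective (φ e))
    (hinv : ∀ (e : E) (a : Ge e),
      inv (bar e) (inv e a) = cast (congrArg Ge (hbar e)).symm a)
    (hconn : ∀ u v : V,
      Relation.ReflTransGen (fun a b : V => ∃ e : E, t (bar e) = a ∧ t e = b) u v)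
    (n : ℕ)
    (Sv : ∀ v : V, Finset (Gv v))
    (hgen : ∀ v, Subgroup.closure ((Sv v : Set (Gv v))) = ⊤)
    (hsym : ∀ v, ∀ s ∈ Sv v, s⁻¹ ∈ Sv v)
    (hasdim : ∀ v : V,
      ASDimLEdist (fun a b : Gv v => (wordDist (Sv v : Set (Gv v)) a b : ℝ)) n)
    (v₀ : V) :
    ASDimLEdist
      (fun a b : {x : GGF bar t Gv Ge φ inv |
          ∃ w : GWord' bar t Gv v₀ v₀, GWord'.eval bar t Gv Ge φ inv w = x} =>
        (wordDist
          ({x : GGF bar t Gv Ge φ inv | ∃ v, ∃ s ∈ Sv v, x = ofV bar t Gv Ge φ inv v s} ∪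
            {x | ∃ e : E, x = ofE bar t Gv Ge φ inv e ∨ x = (ofE bar t Gv Ge φ inv e)⁻¹})
          (a : GGF bar t Gv Ge φ inv) (b : GGF bar t Gv Ge φ inv) : ℝ))
      (n + 1) := by
  have hcount : ∀ v, Countable (Gv v) := by
    intro v
    refine Function.Surjective.countable
      (f := fun l : List (Sv v : Set (Gv v)) => (l.map Subtype.val).prod) ?_
    intro a
    obtain ⟨l, -, h2, h3⟩ := exists_list_wordDist (hgen v) (hsym v) 1 a
    exact ⟨l.attachWith (· ∈ (Sv v : Set (Gv v))) h2, by simpa using h3⟩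
  have hinj := ofV_injective bar t Gv Ge φ inv hbar hφ hinv
  have hgenF : Subgroup.closure (genS (ofVHom bar t Gv Ge φ inv) (ofE bar t Gv Ge φ inv) Sv) =
      ⊤ := by
    rw [eq_top_iff, ← GGF.closure_top, Subgroup.closure_le]
    rintro x (⟨v, a, rfl⟩ | ⟨e, rfl⟩)
    · have ha : a ∈ Subgroup.closure (Sv v : Set (Gv v)) := by rw [hgen]; trivial
      have h1 : ofVHom bar t Gv Ge φ inv v a ∈
          (Subgroup.closure (Sv v : Set (Gv v))).map (ofVHom bar t Gv Ge φ inv v) := ⟨a, ha, rfl⟩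
      rw [MonoidHom.map_closure] at h1
      refine Subgroup.closure_mono ?_ h1
      rintro _ ⟨s, hs, rfl⟩
      exact Or.inl ⟨v, s, hs, rfl⟩
    · exact Subgroup.subset_closure (Or.inr ⟨e, Or.inl rfl⟩)
  have hacyc : (SimpleGraph.fromRel (TStep bar t (fun v => (ofVHom bar t Gv Ge φ inv v).range)
      (ofE bar t Gv Ge φ inv))).IsAcyclic := by
    have hcast : ∀ (e e' : E) (_ : e = e') (a : Ge e'), ofV bar t Gv Ge φ inv (t e') (φ e' a) ∈
        ((ofVHom bar t Gv Ge φ inv (t e)).comp (φ e)).range := by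
      rintro e _ rfl a
      exact ⟨a, rfl⟩
    have hmulr : ∀ e, ofE bar t Gv Ge φ inv e * ofE bar t Gv Ge φ inv (bar e) = 1 := by
      intro e
      have := ofE_bar bar t Gv Ge φ inv (bar e)
      rwa [hbar] at this
    refine tree_acyclic bar t hbar hbarne _ (ofE bar t Gv Ge φ inv)
      (fun e => ((ofVHom bar t Gv Ge φ inv (t e)).comp (φ e)).range) ?_
      (ofE_bar bar t Gv Ge φ inv) ?_ ?_
    · rintro e _ ⟨a, rfl⟩
      exact ⟨φ e a, rfl⟩
    · rintro e _ ⟨b, rfl⟩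
      refine ⟨_, hcast e (bar (bar e)) (hbar e).symm (inv (bar e) b), ?_⟩
      have h1 := ofE_conj bar t Gv Ge φ inv (bar e) b
      rw [← mul_right_inj (ofE bar t Gv Ge φ inv e), ← mul_assoc, hmulr, one_mul] at h1
      change ofV bar t Gv Ge φ inv (t (bar e)) (φ (bar e) b) * _ = _
      rw [h1, mul_assoc, mul_assoc, ofE_bar, mul_one]
    · intro act δ ε h1 h2
      obtain ⟨D, hD1, hD2, hD3⟩ := GGF.exists_crossed bar t Gv Ge φ inv hbar act δ ε h1
        (fun e a => h2 e _ ⟨inv e a, rfl⟩)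
      refine ⟨D, hD1, ?_, hD3⟩
      rintro v _ ⟨a, rfl⟩
      exact hD2 v a
  exact ASDimLEdist_of_coarseCov
    (isDist_wordDist hgenF (genS_symm _ _ Sv hsym))
    (asdim_geometry bar t (ofVHom bar t Gv Ge φ inv) (ofE bar t Gv Ge φ inv) Sv hgenF hgen hsym
      hinj hacyc n hasdim) _
end
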